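/- arXiv:2407.17016 — 2 statements merged into one kernel-verified Lean document; each statement's English description precedes it below -/
import Mathlib

section
/- Orthogonality of the normalized q-Racah polynomials: for all integers n, m with 0 ≤ n ≤ N and 0 ≤ m ≤ N, one has Σ_{x=0}^{N} Ω(x;c₃,c₂,c₁;N)·p_n(x;c₁,c₂,c₃;N)·p_m(x;c₁,c₂,c₃;N) = δ_{n,m}·Ω(n;c₁,c₂,c₃;N), where δ_{n,m} is the Kronecker delta. -/
noncomputable section
namespace qR

/-- q-Pochhammer symbol `(a;q)_k = ∏_{l<k} (1 - a qˡ)`. -/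
def poch (q a : ℂ) (k : ℕ) : ℂ := ∏ l ∈ Finset.range k, (1 - a * q ^ l)

/-- q-binomial coefficient, zero outside `0 ≤ n ≤ N`. -/
def binom (q : ℂ) (N n : ℤ) : ℂ :=
  if 0 ≤ n ∧ n ≤ N then poch q q N.toNat / (poch q q n.toNat * poch q q (N - n).toNat) else 0

/-- Normalisation `Ω(n;c1,c2,c3;N)`; `s` and `t2` are the chosen square roots of `q` and `c2`,
so that `(q c2)^(n - N/2) = (s t2)^(2n - N)`. -/
def Om (q s c1 c2 c3 t2 : ℂ) (N n : ℤ) : ℂ :=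
  binom q N n * (1 - c2 * c3 * q ^ (2 * n + 1)) * poch q (q * c2) n.toNat
      * poch q (c1 * c2 * c3 * q ^ (N + 2)) n.toNat * poch q (q * c1) (N - n).toNat
    / ((s * t2) ^ (2 * n - N) * poch q (c2 * c3 * q ^ (n + 1)) (N + 1).toNat
        * poch q (q * c3) n.toNat)

/-- Normalised q-Racah polynomial `p_n(x;c1,c2,c3;N)`, with the convention that it
vanishes unless `0 ≤ n ≤ N` and `0 ≤ x ≤ N`. -/
def p (q s c1 c2 c3 t2 : ℂ) (N n x : ℤ) : ℂ :=
  if 0 ≤ n ∧ n ≤ N ∧ 0 ≤ x ∧ x ≤ N then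
    Om q s c1 c2 c3 t2 N n *
      ∑ k ∈ Finset.range (n.toNat + 1),
        poch q (q ^ (-n)) k * poch q (c2 * c3 * q ^ (n + 1)) k * poch q (q ^ (-x)) k
            * poch q (c1 * c2 * q ^ (x + 1)) k * q ^ k
          / (poch q (q * c2) k * poch q (c1 * c2 * c3 * q ^ (N + 2)) k
              * poch q (q ^ (-N)) k * poch q q k)
  else 0

/-- `ω_n(c) = (-1)^n c^{n/2} q^{n(n+1)/2}`, where `r` is the chosen square root of `c`. -/
def om (q r : ℂ) (n : ℤ) : ℂ := (-1 : ℂ) ^ n * r ^ n * q ^ (n * (n + 1) / 2)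

/-- `ξ_n(c1,c2) = ((qc1;q)_n/(qc2;q)_n) (c2/c1)^{n/2}`, where `t1, t2` are the chosen
square roots of `c1, c2`. -/
def xi (q c1 c2 t1 t2 : ℂ) (n : ℤ) : ℂ :=
  poch q (q * c1) n.toNat / poch q (q * c2) n.toNat * (t2 / t1) ^ n

/-- `λ(x;c) = -(1-q^{-x})(1-c q^{x+1})`. -/
def lam (q c : ℂ) (x : ℤ) : ℂ := -(1 - q ^ (-x)) * (1 - c * q ^ (x + 1))

def PhiP (q c1 c2 c3 : ℂ) (N n : ℤ) : ℂ :=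
  -c2 * q ^ (n - N) * (1 - q ^ n) * (1 - c1 * q ^ (N - n + 1)) * (1 - c2 * c3 * q ^ (n + N + 1))
      * (1 - c3 * q ^ n)
    / ((1 - c2 * c3 * q ^ (2 * n)) * (1 - c2 * c3 * q ^ (2 * n + 1)))

def PhiM (q c1 c2 c3 : ℂ) (N n : ℤ) : ℂ :=
  (1 - q ^ (n - N)) * (1 - c1 * c2 * c3 * q ^ (n + N + 2)) * (1 - c2 * q ^ (n + 1))
      * (1 - c2 * c3 * q ^ (n + 1))
    / ((1 - c2 * c3 * q ^ (2 * n + 1)) * (1 - c2 * c3 * q ^ (2 * n + 2)))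

/-- `Φ^ε(n;c1,c2,c3;N)`, where `ε = 1, -1, 0` selects `Φ⁺, Φ⁻, Φ⁰`. -/
def Phi (q c1 c2 c3 : ℂ) (N ε n : ℤ) : ℂ :=
  if ε = 1 then PhiP q c1 c2 c3 N n
  else if ε = -1 then PhiM q c1 c2 c3 N n
  else -PhiP q c1 c2 c3 N n - PhiM q c1 c2 c3 N n

/-- `λ₊(x;c1,c2,c3;N)`. -/
def lamP (q c1 c2 c3 : ℂ) (N x : ℤ) : ℂ :=
  -(q ^ (-N - 1) / c3 - q ^ (-x)) * (1 - c1 * c2 * c3 * q ^ (N + x + 2))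

/-- `λ₋(x;c1,c2,c3;N)`. -/
def lamM (q c1 c2 c3 : ℂ) (N x : ℤ) : ℂ :=
  -(q ^ (-N) - q ^ (-x)) * (1 - c1 * c2 * q ^ (N + x + 1))

def PhiPp (q sq c1 c2 c3 : ℂ) (N n : ℤ) : ℂ :=
  -sq * c2 * q ^ (2 * n - N - 1) * (1 - q ^ n) * (1 - c1 * q ^ (N - n + 1))
      * (1 - c1 * q ^ (N + 2 - n)) * (1 - c3 * q ^ n)
    / ((1 - c2 * c3 * q ^ (2 * n)) * (1 - c2 * c3 * q ^ (2 * n + 1)))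

def PhiPm (q sq c1 c2 c3 : ℂ) (N n : ℤ) : ℂ :=
  -((1 - c1 * c2 * c3 * q ^ (n + N + 2)) * (1 - c1 * c2 * c3 * q ^ (n + N + 3))
      * (1 - c2 * q ^ (n + 1)) * (1 - c2 * c3 * q ^ (n + 1)))
    / (c3 * q ^ (N + 1) * sq * (1 - c2 * c3 * q ^ (2 * n + 1)) * (1 - c2 * c3 * q ^ (2 * n + 2)))

def PhiP0 (q sq c1 c2 c3 : ℂ) (N n : ℤ) : ℂ :=
  -PhiPp q sq c1 c2 c3 N n - PhiPm q sq c1 c2 c3 N n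
    - (1 - c1 * c2 * q ^ (N + 2)) * (1 - c1 * c2 * c3 * q ^ (N + 2)) / (c3 * q ^ (N + 1) * sq)

def PhiMp (q sq c1 c2 c3 : ℂ) (N n : ℤ) : ℂ :=
  -sq * (1 - q ^ n) * (1 - c3 * q ^ n) * (1 - c2 * c3 * q ^ (n + N))
      * (1 - c2 * c3 * q ^ (n + N + 1))
    / (q ^ N * (1 - c2 * c3 * q ^ (2 * n)) * (1 - c2 * c3 * q ^ (2 * n + 1)))

def PhiMm (q sq c1 c2 c3 : ℂ) (N n : ℤ) : ℂ :=
  -c3 * sq * q ^ N * (1 - q ^ (n - N)) * (1 - q ^ (n - N + 1)) * (1 - c2 * q ^ (n + 1))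
      * (1 - c2 * c3 * q ^ (n + 1))
    / ((1 - c2 * c3 * q ^ (2 * n + 1)) * (1 - c2 * c3 * q ^ (2 * n + 2)))

def PhiM0 (q sq c1 c2 c3 : ℂ) (N n : ℤ) : ℂ :=
  -PhiMp q sq c1 c2 c3 N n - PhiMm q sq c1 c2 c3 N n - sq * (1 - c3 * q ^ N) * (q ^ (-N) - 1)

/-- Contiguity coefficient `Φ_σ^ε(n;c1,c2,c3;N)`, where `σ = 1` is the `+` and `σ = -1`
the `-` family, `ε ∈ {1,0,-1}` selects the superscript, and `sq` is the chosen square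
root of `q c2`. -/
def PhiC (q sq c1 c2 c3 : ℂ) (σ ε N n : ℤ) : ℂ :=
  if σ = 1 then
    if ε = 1 then PhiPp q sq c1 c2 c3 N n
    else if ε = -1 then PhiPm q sq c1 c2 c3 N n
    else PhiP0 q sq c1 c2 c3 N n
  else
    if ε = 1 then PhiMp q sq c1 c2 c3 N n
    else if ε = -1 then PhiMm q sq c1 c2 c3 N n
    else PhiM0 q sq c1 c2 c3 N n

def Fp (q c1 c2 : ℂ) (x : ℤ) : ℂ :=
  c1 * c2 ^ 2 * q ^ (x + 1) * (1 - c1 * q ^ x) * (1 - q ^ x)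
    / ((1 - c1 * c2 * q ^ (2 * x)) * (1 - c1 * c2 * q ^ (2 * x + 1)))

def Fm (q c1 c2 : ℂ) (x : ℤ) : ℂ :=
  c1 * c2 * q ^ (x + 1) * (1 - c2 * q ^ (x + 1)) * (1 - c1 * c2 * q ^ (x + 1))
    / ((1 - c1 * c2 * q ^ (2 * x + 1)) * (1 - c1 * c2 * q ^ (2 * x + 2)))

/-- The coefficients `A^{ε,ε'}_{i,j}(c1,c2,c3,c4;N)` for `(ε,ε') ≠ (0,0)`;
`t2` is the chosen square root of `c2` and the fifth parameter
`c0 = (q^{2N+3} c1 c2 c3 c4)⁻¹` is computed internally. -/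
def Aaux (q s c1 c2 c3 c4 t2 : ℂ) (N ε ε' i j : ℤ) : ℂ :=
  if ε' = 1 ∨ ε' = -1 then
    -c3 * q ^ (N + 1) *
        (if ε' = 1 then Fp q c4 ((q ^ (2 * N + 3) * c1 * c2 * c3 * c4)⁻¹) j
         else Fm q c4 ((q ^ (2 * N + 3) * c1 * c2 * c3 * c4)⁻¹) j) *
        PhiC q (s * t2) c1 c2 c3 ε' ε (N - j) i
  else if ε = 1 ∨ ε = -1 then
    c3 * q ^ (N + 1) *
        (Fp q c4 ((q ^ (2 * N + 3) * c1 * c2 * c3 * c4)⁻¹) j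
          + Fm q c4 ((q ^ (2 * N + 3) * c1 * c2 * c3 * c4)⁻¹) j) *
        Phi q c1 c2 c3 (N - j) ε i
  else 0

/-- The coefficients `A^{ε,ε'}_{i,j}(c1,c2,c3,c4;N)`. -/
def A (q s c1 c2 c3 c4 t2 : ℂ) (N ε ε' i j : ℤ) : ℂ :=
  if ε = 0 ∧ ε' = 0 then
    -((1 - c3 * q ^ (N + 1 - j)) * (s * t2) / (1 - c1 * c2 * q ^ (N + 2 - j)))
          * ∑ e ∈ ({-1, 0, 1} : Finset ℤ), Aaux q s c1 c2 c3 c4 t2 N e 1 i j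
      - (1 - c1 * c2 * q ^ (N + 1 - j)) / ((1 - c3 * q ^ (N - j)) * (s * t2))
          * ∑ e ∈ ({-1, 0, 1} : Finset ℤ), Aaux q s c1 c2 c3 c4 t2 N e (-1) i j
      - ∑ e ∈ ({-1, 1} : Finset ℤ), Aaux q s c1 c2 c3 c4 t2 N e 0 i j
  else Aaux q s c1 c2 c3 c4 t2 N ε ε' i j

/-- `Λ(x;c1,c2,c3,c4;N)`; `s, t1, t2, t3, t4` are the chosen square roots of
`q, c1, c2, c3, c4`. -/
def Lam (q s c1 c2 c3 c4 t1 t2 t3 t4 : ℂ) (N x : ℤ) : ℂ :=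
  (-1 : ℂ) ^ x * binom q N x * (1 - c1 * c2 * q ^ (2 * x + 1)) * poch q (q * c2) x.toNat
      * (s * t2) ^ N * (t1 * t3 / (t2 * t4)) ^ x * q ^ (x * (x - 1) / 2)
    / (poch q (q * c1) x.toNat * poch q (q ^ (x + 1) * c1 * c2) (N + 1).toNat)

/-- Tratnik polynomial of q-Racah type `T_{i,j}(x,y;c1,c2,c3,c4;N)`; the fifth parameter
`c0 = (q^{2N+3} c1 c2 c3 c4)⁻¹` and its square root `t0 = (s^{2N+3} t1 t2 t3 t4)⁻¹`
are computed internally. -/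
def T (q s c1 c2 c3 c4 t1 t2 t3 t4 : ℂ) (N i j x y : ℤ) : ℂ :=
  if 0 ≤ i ∧ 0 ≤ j ∧ i + j ≤ N then
    p q s c1 c2 c3 t2 (N - j) i x *
      p q s c3 ((q ^ (2 * N + 3) * c1 * c2 * c3 * c4)⁻¹) c4
        ((s ^ (2 * N + 3) * t1 * t2 * t3 * t4)⁻¹) (N - x) j y
  else 0

/-- Griffiths polynomial of q-Racah type `G_{i,j}(x,y;c1,c2,c3,c4;N)`; the fifth parameter
`c0 = (q^{2N+3} c1 c2 c3 c4)⁻¹` and its square root `t0 = (s^{2N+3} t1 t2 t3 t4)⁻¹`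
are computed internally. -/
def G (q s c1 c2 c3 c4 t1 t2 t3 t4 : ℂ) (N i j x y : ℤ) : ℂ :=
  if 0 ≤ i ∧ 0 ≤ j ∧ i + j ≤ N then
    ∑ a ∈ Finset.range ((min (N - j) (N - y)).toNat + 1),
      om q (t1 * t2 * t3 / t4) (a : ℤ) * p q s c1 c2 c3 t2 (N - j) i (a : ℤ) *
        p q s c3 ((q ^ (2 * N + 3) * c1 * c2 * c3 * c4)⁻¹) c4
          ((s ^ (2 * N + 3) * t1 * t2 * t3 * t4)⁻¹) (N - (a : ℤ)) j y *
        p q s c4 c2 c1 t2 (N - y) (a : ℤ) x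
  else 0


theorem poch_zero (q a : ℂ) : poch q a 0 = 1 := by simp [poch]
theorem poch_succ (q a : ℂ) (k : ℕ) : poch q a (k + 1) = poch q a k * (1 - a * q ^ k) := by
  simp [poch, Finset.prod_range_succ]
theorem poch_succ' (q a : ℂ) (k : ℕ) : poch q a (k + 1) = (1 - a) * poch q (a * q) k := by
  simp only [poch, Finset.prod_range_succ']
  rw [mul_comm]
  congr 1
  · simp
  · apply Finset.prod_congr rfl; intros; ring
theorem poch_shift (q a : ℂ) (k : ℕ) : (1 - a) * poch q (a * q) k = poch q a k * (1 - a * q ^ k) := by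
  rw [← poch_succ', poch_succ]
theorem poch_ne (q a : ℂ) (k : ℕ) (h : ∀ l < k, 1 - a * q ^ l ≠ 0) : poch q a k ≠ 0 := by
  rw [poch, Finset.prod_ne_zero_iff]
  intro l hl
  exact h l (Finset.mem_range.1 hl)

structure Gen (q c1 c2 c3 : ℂ) (N : ℕ) : Prop where
  q0 : q ≠ 0
  c20 : c2 ≠ 0
  g1 : ∀ k : ℕ, 1 ≤ k → k ≤ 2 * N + 5 → 1 - c1 * q ^ k ≠ 0
  g2 : ∀ k : ℕ, 1 ≤ k → k ≤ 2 * N + 5 → 1 - c2 * q ^ k ≠ 0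
  g3 : ∀ k : ℕ, 1 ≤ k → k ≤ 2 * N + 5 → 1 - c3 * q ^ k ≠ 0
  g12 : ∀ k : ℕ, 1 ≤ k → k ≤ 2 * N + 5 → 1 - c1 * c2 * q ^ k ≠ 0
  g23 : ∀ k : ℕ, 1 ≤ k → k ≤ 2 * N + 5 → 1 - c2 * c3 * q ^ k ≠ 0
  g123 : ∀ k : ℕ, 1 ≤ k → k ≤ 2 * N + 5 → 1 - c1 * c2 * c3 * q ^ k ≠ 0
  gq : ∀ k : ℕ, 1 ≤ k → k ≤ N → 1 - q ^ k ≠ 0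

theorem Gen.symm {q c1 c2 c3 : ℂ} {N : ℕ} (h : Gen q c1 c2 c3 N) : Gen q c3 c2 c1 N where
  q0 := h.q0
  c20 := h.c20
  g1 := h.g3
  g2 := h.g2
  g3 := h.g1
  g12 := fun k h1 h2 => by rw [mul_comm c3]; exact h.g23 k h1 h2
  g23 := fun k h1 h2 => by rw [mul_comm c2]; exact h.g12 k h1 h2
  g123 := fun k h1 h2 => by
    have := h.g123 k h1 h2
    rwa [show c3 * c2 * c1 = c1 * c2 * c3 by ring]
  gq := h.gq

theorem Gen.s23 {q c1 c2 c3 : ℂ} {N : ℕ} (h : Gen q c1 c2 c3 (N + 1)) :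
    Gen q c1 (q * c2) (q * c3) N where
  q0 := h.q0
  c20 := mul_ne_zero h.q0 h.c20
  g1 := fun k h1 h2 => h.g1 k h1 (by omega)
  g2 := fun k h1 h2 => by
    have := h.g2 (k + 1) (by omega) (by omega)
    convert this using 1; ring
  g3 := fun k h1 h2 => by
    have := h.g3 (k + 1) (by omega) (by omega)
    convert this using 1; ring
  g12 := fun k h1 h2 => by
    have := h.g12 (k + 1) (by omega) (by omega)
    convert this using 1; ring
  g23 := fun k h1 h2 => by
    have := h.g23 (k + 2) (by omega) (by omega)
    convert this using 1; ring
  g123 := fun k h1 h2 => by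
    have := h.g123 (k + 2) (by omega) (by omega)
    convert this using 1; ring
  gq := fun k h1 h2 => h.gq k h1 (by omega)

theorem Gen.s12 {q c1 c2 c3 : ℂ} {N : ℕ} (h : Gen q c1 c2 c3 (N + 1)) :
    Gen q (q * c1) (q * c2) c3 N := h.symm.s23.symm

def ww (q c1 c2 c3 : ℂ) (N n : ℕ) : ℂ :=
  poch q q N / (poch q q n * poch q q (N - n)) * (1 - c2 * c3 * q ^ (2 * n + 1))
      * poch q (q * c2) n * poch q (c1 * c2 * c3 * q ^ (N + 2)) n * poch q (q * c1) (N - n)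
    / ((q * c2) ^ n * poch q (c2 * c3 * q ^ (n + 1)) (N + 1) * poch q (q * c3) n)

theorem pq_ne {q c1 c2 c3 : ℂ} {N : ℕ} (h : Gen q c1 c2 c3 N) (k : ℕ) (hk : k ≤ N) :
    poch q q k ≠ 0 := by
  apply poch_ne
  intro l hl
  have := h.gq (l + 1) (by omega) (by omega)
  convert this using 1; ring
theorem p1_ne {q c1 c2 c3 : ℂ} {N : ℕ} (h : Gen q c1 c2 c3 N) (k : ℕ) (hk : k ≤ 2 * N + 5) :
    poch q (q * c1) k ≠ 0 := by
  apply poch_ne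
  intro l hl
  have := h.g1 (l + 1) (by omega) (by omega)
  convert this using 1; ring
theorem p2_ne {q c1 c2 c3 : ℂ} {N : ℕ} (h : Gen q c1 c2 c3 N) (k : ℕ) (hk : k ≤ 2 * N + 5) :
    poch q (q * c2) k ≠ 0 := by
  apply poch_ne
  intro l hl
  have := h.g2 (l + 1) (by omega) (by omega)
  convert this using 1; ring
theorem p3_ne {q c1 c2 c3 : ℂ} {N : ℕ} (h : Gen q c1 c2 c3 N) (k : ℕ) (hk : k ≤ 2 * N + 5) :
    poch q (q * c3) k ≠ 0 := p1_ne h.symm k hk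
theorem p23_ne {q c1 c2 c3 : ℂ} {N : ℕ} (h : Gen q c1 c2 c3 N) (j k : ℕ) (hk : j + k ≤ 2 * N + 5) :
    poch q (c2 * c3 * q ^ (j + 1)) k ≠ 0 := by
  apply poch_ne
  intro l hl
  have := h.g23 (l + j + 1) (by omega) (by omega)
  convert this using 1; ring
theorem p123_ne {q c1 c2 c3 : ℂ} {N : ℕ} (h : Gen q c1 c2 c3 N) (k : ℕ) (hk : k ≤ N) :
    poch q (c1 * c2 * c3 * q ^ (N + 2)) k ≠ 0 := by
  apply poch_ne
  intro l hl
  have := h.g123 (l + N + 2) (by omega) (by omega)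
  convert this using 1; ring
theorem pN_ne {q c1 c2 c3 : ℂ} {N : ℕ} (h : Gen q c1 c2 c3 N) (k : ℕ) (hk : k ≤ N) :
    poch q ((q ^ N)⁻¹) k ≠ 0 := by
  apply poch_ne
  intro l hl
  have := h.gq (N - l) (by omega) (by omega)
  have h0 := h.q0
  obtain ⟨d, rfl⟩ : ∃ d, N = l + d := ⟨N - l, by omega⟩
  simp at this
  contrapose! this
  have : (q ^ (l + d))⁻¹ * q ^ l = 1 := by linear_combination -this
  field_simp at this
  rw [pow_add] at this
  have h1 : q ^ l ≠ 0 := pow_ne_zero _ h0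
  have : q ^ l * 1 = q ^ l * q ^ d := by rw [← this]; ring
  have := mul_left_cancel₀ h1 this
  rw [← this]; ring

theorem ww_ne {q c1 c2 c3 : ℂ} {N : ℕ} (h : Gen q c1 c2 c3 N) (n : ℕ) (hn : n ≤ N) :
    ww q c1 c2 c3 N n ≠ 0 := by
  have := h.g23 (2 * n + 1) (by omega) (by omega)
  have := pq_ne h N le_rfl
  have := pq_ne h n hn
  have := pq_ne h (N - n) (by omega)
  have := p2_ne h n (by omega)
  have := p3_ne h n (by omega)
  have := p1_ne h (N - n) (by omega)
  have := p23_ne h n (N + 1) (by omega)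
  have := p123_ne h n hn
  have := h.q0
  have := h.c20
  unfold ww
  positivity

theorem ww_succ {q c1 c2 c3 : ℂ} {N : ℕ} (h : Gen q c1 c2 c3 (N + 1)) (n : ℕ) (hn : n ≤ N) :
    ww q c1 c2 c3 (N + 1) (n + 1) = (1 - q ^ (N + 1)) / (1 - q ^ (n + 1)) * (1 - q * c2)
      * (1 - c1 * c2 * c3 * q ^ (N + 3)) / ((1 - q * c3) * (1 - c2 * c3 * q ^ (n + 2)))
      * (q ^ n / (q * c2)) * ww q c1 (q * c2) (q * c3) N n := by
  unfold ww
  have e1 : N + 1 - (n + 1) = N - n := by omega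
  rw [e1, poch_succ q q N, poch_succ q q n, poch_succ' q (q * c2) n, poch_succ' q (q * c3) n,
    poch_succ' q _ (N + 1), poch_succ' q (c1 * c2 * c3 * _) n]
  rw [show q * c2 * q = q * (q * c2) by ring, show q * c3 * q = q * (q * c3) by ring,
    show c2 * c3 * q ^ (n + 1 + 1) * q = q * c2 * (q * c3) * q ^ (n + 1) by ring,
    show c1 * c2 * c3 * q ^ (N + 1 + 2) * q = c1 * (q * c2) * (q * c3) * q ^ (N + 2) by ring,
    show c2 * c3 * q ^ (2 * (n + 1) + 1) = q * c2 * (q * c3) * q ^ (2 * n + 1) by ring,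
    show (q * (q * c2)) ^ n = q ^ n * (q * c2) ^ n by ring]
  have := h.q0
  have b1 := pq_ne h n (by omega)
  have b2 := pq_ne h (N - n) (by omega)
  have b3 := p23_ne h.s23 n (N + 1) (by omega)
  have b4 := p3_ne h.s23 n (by omega)
  have b5 := h.g3 1 (by omega) (by omega)
  have b6 := h.gq (n + 1) (by omega) (by omega)
  have b7 := h.g23 (n + 2) (by omega) (by omega)
  have b8 := mul_ne_zero h.q0 h.c20
  have b9 := pow_ne_zero n b8
  rw [show c3 * q ^ 1 = q * c3 by ring] at b5
  have h2 : q ^ n ≠ 0 := pow_ne_zero _ this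
  rw [show q * q ^ N = q ^ (N + 1) by ring, show q * q ^ n = q ^ (n + 1) by ring,
    show n + 1 + 1 = n + 2 by ring, show N + 1 + 2 = N + 3 by ring]
  generalize poch q (q * c2 * (q * c3) * q ^ (n + 1)) (N + 1) = z1 at *
  generalize poch q (q * (q * c2)) n = z2 at *
  generalize poch q (q * (q * c3)) n = z3 at *
  generalize poch q (c1 * (q * c2) * (q * c3) * q ^ (N + 2)) n = z4 at *
  generalize poch q q n = z5 at *
  generalize poch q q N = z6 at *
  generalize poch q q (N - n) = z7 at *
  rw [pow_succ (q * c2)]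
  generalize (q * c2) ^ n = z8 at *
  generalize q * c2 * (q * c3) * q ^ (2 * n + 1) = z9 at *
  generalize q * c2 = y1 at *
  generalize 1 - q * c3 = y2 at *
  generalize 1 - q ^ (n + 1) = y3 at *
  generalize 1 - q ^ (N + 1) = y4 at *
  generalize 1 - c2 * c3 * q ^ (n + 2) = y5 at *
  generalize 1 - c1 * c2 * c3 * q ^ (N + 3) = y6 at *
  generalize q ^ n = y7 at *
  generalize poch q _ _ = y8 at *
  field_simp

def Bt (q c1 c2 c3 : ℂ) (N x : ℕ) : ℂ :=
  (1 - q ^ N * (q ^ x)⁻¹) * (1 - c2 * q ^ (x + 1)) * (1 - c1 * c2 * c3 * q ^ (N + 2 + x))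
    / (1 - c1 * c2 * q ^ (2 * x + 1))

def Dt (q c1 c2 c3 : ℂ) (N x : ℕ) : ℂ :=
  -(q * c2 * q ^ x * (1 - c1 * q ^ x) * (1 - c3 * q ^ (N + 1) * (q ^ x)⁻¹)
    * (1 - c1 * c2 * q ^ (x + N + 1)))
    / (1 - c1 * c2 * q ^ (2 * x + 1))

def vv (q c1 c2 c3 : ℂ) (N x : ℕ) : ℂ :=
  ww q c3 c2 c1 N x * (Bt q c1 c2 c3 N x * (1 - c1 * c2 * q ^ (x + 1)))

theorem vv_top {q c1 c2 c3 : ℂ} {N : ℕ} (h : q ≠ 0) : vv q c1 c2 c3 N N = 0 := by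
  have h2 : q ^ N ≠ 0 := pow_ne_zero _ h
  simp [vv, Bt, h2]

theorem vv_eq {q c1 c2 c3 : ℂ} {N : ℕ} (h : Gen q c1 c2 c3 (N + 1)) (x : ℕ) (hx : x ≤ N) :
    vv q c1 c2 c3 (N + 1) x = ww q c3 c2 c1 (N + 1) (x + 1)
      * (Dt q c1 c2 c3 (N + 1) (x + 1) * (1 - (q ^ (x + 1))⁻¹)) := by
  obtain ⟨d, rfl⟩ : ∃ d, N = x + d := ⟨N - x, by omega⟩
  unfold vv ww Bt Dt
  rw [show x + d + 1 - x = d + 1 by omega, show x + d + 1 - (x + 1) = d by omega]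
  have hz := poch_shift q (c2 * c1 * q ^ (x + 1)) (x + d + 1 + 1)
  rw [show c2 * c1 * q ^ (x + 1) * q = c2 * c1 * q ^ (x + 1 + 1) by ring] at hz
  have a1 := h.g12 (x + 1) (by omega) (by omega)
  have a2 := h.g12 (x + 1 + (x + d + 2)) (by omega) (by omega)
  have a3 := p23_ne h.symm x (x + d + 1 + 1) (by omega)
  have a4 := p23_ne h.symm (x + 1) (x + d + 1 + 1) (by omega)
  have a5 := h.g12 (2 * x + 1) (by omega) (by omega)
  have a6 := h.g12 (2 * (x + 1) + 1) (by omega) (by omega)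
  have a7 := h.g3 (d + 1) (by omega) (by omega)
  have a8 := h.gq (x + 1) (by omega) (by omega)
  have a9 := h.gq (d + 1) (by omega) (by omega)
  have a10 := h.g1 (x + 1) (by omega) (by omega)
  have a11 := pq_ne h x (by omega)
  have a12 := pq_ne h d (by omega)
  have a13 := p1_ne h x (by omega)
  have a14 := h.q0
  have a15 := h.c20
  have a16 : q ^ x ≠ 0 := pow_ne_zero _ a14
  rw [poch_succ q q x, poch_succ q q d, poch_succ q (q * c2) x, poch_succ q (q * c1) x,
    poch_succ q (q * c3) d, poch_succ q (c3 * c2 * c1 * _) x]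
  generalize poch q (c2 * c1 * q ^ (x + 1)) (x + d + 1 + 1) = z1 at *
  generalize poch q (c2 * c1 * q ^ (x + 1 + 1)) (x + d + 1 + 1) = z2 at *
  generalize poch q (q * c2) x = z3 at *
  generalize poch q (q * c1) x = z4 at *
  generalize poch q (q * c3) d = z5 at *
  generalize poch q (c3 * c2 * c1 * _) x = z6 at *
  generalize poch q q x = z7 at *
  generalize poch q q d = z8 at *
  generalize poch q q _ = z9 at *
  have hz' : z1 = (1 - c2 * c1 * q ^ (x + 1)) * z2 /
     (1 - c1 * c2 * q ^ (x + 1 + (x + d + 2))) := by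
    rw [eq_div_iff a2]
    linear_combination -hz
  have hne : 1 - c1 * c2 * q ^ (x + d + 1 + (x + 1) + 1) ≠ 0 := by
    convert a2 using 3; congr 1; ring
  rw [hz', pow_succ (q * c2) x]
  generalize hw : (q * c2) ^ x = w
  have hw0 : w ≠ 0 := by rw [← hw]; exact pow_ne_zero _ (mul_ne_zero a14 a15)
  rw [show q * q ^ x = q ^ (x + 1) by ring, show q * q ^ d = q ^ (d + 1) by ring,
    show q * c1 * q ^ x = c1 * q ^ (x + 1) by ring]
  rw [show c2 * c1 = c1 * c2 by ring]
  rw [show q ^ (x + d + 1) * (q ^ x)⁻¹ = q ^ (d + 1) by field_simp; ring,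
    show c3 * q ^ (x + d + 1 + 1) * (q ^ (x + 1))⁻¹ = c3 * q ^ (d + 1) by field_simp; ring]
  rw [show (1 - (q ^ (x + 1))⁻¹) = -(1 - q ^ (x + 1)) * (q ^ (x + 1))⁻¹ by field_simp; ring]
  rw [show q * c3 * q ^ d = c3 * q ^ (d + 1) by ring,
    show q * c2 * q ^ x = c2 * q ^ (x + 1) by ring,
    show c3 * c2 * c1 * q ^ (x + d + 1 + 2) * q ^ x = c1 * c2 * c3 * q ^ (x + d + 1 + 2 + x) by ring,
    show x + 1 + (x + d + 1) + 1 = x + 1 + (x + d + 2) by ring]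
  generalize 1 - c1 * c2 * q ^ (x + 1) = y1 at *
  generalize 1 - c1 * c2 * q ^ (x + 1 + (x + d + 2)) = y2 at *
  generalize 1 - c1 * c2 * q ^ (2 * x + 1) = y3 at *
  generalize 1 - c1 * c2 * q ^ (2 * (x + 1) + 1) = y4 at *
  generalize 1 - c3 * q ^ (d + 1) = y5 at *
  generalize 1 - q ^ (d + 1) = y6 at *
  generalize 1 - q ^ (x + 1) = y7 at *
  generalize 1 - c1 * q ^ (x + 1) = y8 at *
  generalize 1 - c2 * q ^ (x + 1) = y9 at *
  field_simp

theorem vv_ww {q c1 c2 c3 : ℂ} {N : ℕ} (h : Gen q c1 c2 c3 (N + 1)) (x : ℕ) (hx : x ≤ N) :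
    vv q c1 c2 c3 (N + 1) x * ((q ^ x)⁻¹ * (1 - c1 * c2 * q ^ (2 * x + 2)))
      = (1 - q ^ (N + 1)) * (1 - q * c2) * (1 - c1 * c2 * c3 * q ^ (N + 3)) * (1 - q * c3)
       * ww q (q * c3) (q * c2) c1 N x := by
  obtain ⟨d, rfl⟩ : ∃ d, N = x + d := ⟨N - x, by omega⟩
  unfold vv ww Bt
  rw [show x + d + 1 - x = d + 1 by omega, show x + d - x = d by omega]
  have hz2 := poch_shift q (q * c2) x
  have hz3 := poch_shift q (c3 * c2 * c1 * q ^ (x + d + 3)) x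
  have a1 := h.g12 (x + 1) (by omega) (by omega)
  have a3 := p23_ne h.symm (x + 1) (x + d + 1) (by omega)
  have a5 := h.g12 (2 * x + 1) (by omega) (by omega)
  have a9 := h.gq (d + 1) (by omega) (by omega)
  have a11 := pq_ne h x (by omega)
  have a12 := pq_ne h d (by omega)
  have a13 := p1_ne h x (by omega)
  have a14 := h.q0
  have a15 := h.c20
  have a16 : q ^ x ≠ 0 := pow_ne_zero _ a14
  rw [poch_succ' q _ (x + d + 1), poch_succ q q d, poch_succ q q (x + d), poch_succ' q (q * c3) d]
  rw [show q * c2 * q = q * (q * c2) by ring] at hz2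
  rw [show c3 * c2 * c1 * q ^ (x + d + 3) * q = q * c3 * (q * c2) * c1 * q ^ (x + d + 2) by ring,
    show x + d + 3 = x + d + 1 + 2 by ring] at hz3
  rw [show q * c3 * q = q * (q * c3) by ring,
    show c2 * c1 * q ^ (x + 1) * q = c2 * c1 * q ^ (x + 1 + 1) by ring,
    show q * c2 * c1 * q ^ (x + 1) = c2 * c1 * q ^ (x + 1 + 1) by ring,
    show (q * (q * c2)) ^ x = q ^ x * (q * c2) ^ x by ring]
  generalize poch q (c2 * c1 * q ^ (x + 1 + 1)) (x + d + 1) = z1 at *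
  generalize poch q (q * c2) x = z2 at *
  generalize poch q (q * (q * c2)) x = z3 at *
  generalize poch q (c3 * c2 * c1 * _) x = z4 at *
  generalize poch q (q * c3 * (q * c2) * c1 * _) x = z5 at *
  generalize poch q q x = z7 at *
  generalize poch q q d = z8 at *
  generalize poch q q _ = z9 at *
  generalize poch q (q * (q * c3)) d = z10 at *
  generalize poch q (q * c1) x = z11 at *
  generalize hw : (q * c2) ^ x = w
  have hw0 : w ≠ 0 := by rw [← hw]; exact pow_ne_zero _ (mul_ne_zero a14 a15)
  rw [show q * q ^ d = q ^ (d + 1) by ring, show q * q ^ (x + d) = q ^ (x + d + 1) by ring]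
  rw [show q ^ (x + d + 1) * (q ^ x)⁻¹ = q ^ (d + 1) by field_simp; ring]
  rw [show q * c2 * q ^ x = c2 * q ^ (x + 1) by ring] at hz2
  rw [show c3 * c2 * c1 * q ^ (x + d + 1 + 2) * q ^ x = c1 * c2 * c3 * q ^ (x + d + 1 + 2 + x) by ring] at hz3
  rw [show c3 * c2 * c1 = c1 * c2 * c3 by ring] at hz3
  rw [show c2 * c1 = c1 * c2 by ring, show q * c2 * c1 * q ^ (2 * x + 1) = c1 * c2 * q ^ (2 * x + 2) by ring,
    show x + d + 3 = x + d + 1 + 2 by ring]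
  generalize 1 - c1 * c2 * q ^ (x + 1) = y1 at *
  generalize 1 - c1 * c2 * q ^ (2 * x + 1) = y3 at *
  generalize 1 - q ^ (d + 1) = y6 at *
  generalize 1 - c2 * q ^ (x + 1) = y9 at *
  generalize 1 - c1 * c2 * q ^ (2 * x + 2) = y10 at *
  generalize 1 - c1 * c2 * c3 * q ^ (x + d + 1 + 2 + x) = y11 at *
  generalize 1 - c1 * c2 * c3 * q ^ (x + d + 1 + 2) = y12 at *
  generalize 1 - q * c2 = y13 at *
  have e : (1 - q ^ (x + d + 1)) * y13 * y12 * (1 - q * c3) * (z9 / (z7 * z8) * y10 * z3 * z5 * z10 /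
     (q ^ x * w * z1 * z11)) = (1 - q ^ (x + d + 1)) * (1 - q * c3) * (z9 / (z7 * z8) * y10 * (y13 * z3) * (y12 * z5) * z10 /
     (q ^ x * w * z1 * z11)) := by ring
  rw [e, hz2, hz3]
  field_simp

def phi (q c : ℂ) (x k : ℕ) : ℂ := poch q ((q ^ x)⁻¹) k * poch q (c * q ^ (x + 1)) k

def rr (q c1 c2 c3 : ℂ) (N n k : ℕ) : ℂ :=
  poch q ((q ^ n)⁻¹) k * poch q (c2 * c3 * q ^ (n + 1)) k * q ^ k
    / (poch q (q * c2) k * poch q (c1 * c2 * c3 * q ^ (N + 2)) k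
              * poch q ((q ^ N)⁻¹) k * poch q q k)

def RR (q c1 c2 c3 : ℂ) (N n x : ℕ) : ℂ :=
  ∑ k ∈ Finset.range (n + 1), rr q c1 c2 c3 N n k * phi q (c1 * c2) x k

theorem phi_fwd {q c : ℂ} (hq : q ≠ 0) (x k : ℕ) :
    phi q c (x + 1) (k + 1) - phi q c x (k + 1)
      = -(1 - q ^ (k + 1)) * ((q ^ (x + 1))⁻¹ * (1 - c * q ^ (2 * x + 2))) * phi q (q * c) x k := by
  unfold phi
  have h1 : q ^ x ≠ 0 := pow_ne_zero _ hq
  rw [poch_succ' q ((q ^ (x + 1))⁻¹), poch_succ q ((q ^ x)⁻¹), poch_succ q (c * q ^ (x + 1 + 1)),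
    poch_succ' q (c * q ^ (x + 1))]
  rw [show (q ^ (x + 1))⁻¹ * q = (q ^ x)⁻¹ by field_simp; ring,
    show q * c * q ^ (x + 1) = c * q ^ (x + 1 + 1) by ring,
    show c * q ^ (x + 1) * q = c * q ^ (x + 1 + 1) by ring]
  generalize poch q _ k = z1
  generalize poch q _ k = z2
  field_simp
  ring

theorem rr_fwd {q c1 c2 c3 : ℂ} {N : ℕ} (h : Gen q c1 c2 c3 (N + 1)) (n k : ℕ) (hk : k ≤ N) :
    rr q c1 c2 c3 (N + 1) (n + 1) (k + 1) * (1 - q ^ (k + 1))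
     = (1 - (q ^ (n + 1))⁻¹) * (1 - c2 * c3 * q ^ (n + 2)) * q / ((1 - q * c2)
        * (1 - c1 * c2 * c3 * q ^ (N + 3)) * (1 - (q ^ (N + 1))⁻¹))
        * rr q c1 (q * c2) (q * c3) N n k := by
  have hq := h.q0
  unfold rr
  have a8 := h.gq (k + 1) (by omega) (by omega)
  rw [poch_succ' q ((q ^ (n + 1))⁻¹), poch_succ' q (c2 * c3 * _), poch_succ' q (q * c2),
    poch_succ' q (c1 * c2 * c3 * _), poch_succ' q ((q ^ (N + 1))⁻¹), poch_succ q q]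
  rw [show (q ^ (n + 1))⁻¹ * q = (q ^ n)⁻¹ by field_simp; ring,
    show (q ^ (N + 1))⁻¹ * q = (q ^ N)⁻¹ by field_simp; ring,
    show q * c2 * q = q * (q * c2) by ring,
    show c2 * c3 * q ^ (n + 1 + 1) * q = q * c2 * (q * c3) * q ^ (n + 1) by ring,
    show c1 * c2 * c3 * q ^ (N + 1 + 2) * q = c1 * (q * c2) * (q * c3) * q ^ (N + 2) by ring,
    show q * q ^ k = q ^ (k + 1) by ring, show n + 1 + 1 = n + 2 by ring,
    show N + 1 + 2 = N + 3 by ring]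
  generalize 1 - (q ^ (N + 1))⁻¹ = y1 at *
  generalize 1 - (q ^ (n + 1))⁻¹ = y2 at *
  rw [pow_succ q k]
  rw [pow_succ q k] at a8
  generalize poch q _ k = z1
  generalize poch q _ k = z2
  generalize poch q _ k = z3
  generalize poch q _ k = z4
  generalize poch q _ k = z5
  generalize poch q _ k = z6
  generalize 1 - q ^ k * q = y3 at *
  field_simp

theorem RR_fwd {q c1 c2 c3 : ℂ} {N : ℕ} (h : Gen q c1 c2 c3 (N + 1)) (n x : ℕ) (hn : n ≤ N) :
    RR q c1 c2 c3 (N + 1) (n + 1) (x + 1) - RR q c1 c2 c3 (N + 1) (n + 1) x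
     = -((1 - (q ^ (n + 1))⁻¹) * (1 - c2 * c3 * q ^ (n + 2)) * q / ((1 - q * c2)
        * (1 - c1 * c2 * c3 * q ^ (N + 3)) * (1 - (q ^ (N + 1))⁻¹)))
        * ((q ^ (x + 1))⁻¹ * (1 - c1 * c2 * q ^ (2 * x + 2)))
        * RR q c1 (q * c2) (q * c3) N n x := by
  unfold RR
  rw [← Finset.sum_sub_distrib, Finset.sum_range_succ', Finset.mul_sum]
  have : ∀ y, phi q (c1 * c2) y 0 = 1 := by intro y; simp [phi, poch_zero]
  rw [this, this, sub_self, add_zero]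
  apply Finset.sum_congr rfl
  intro k hk
  have hk := Finset.mem_range.1 hk
  rw [← mul_sub, phi_fwd h.q0, show c1 * (q * c2) = q * (c1 * c2) by ring]
  have := rr_fwd h n k (by omega)
  linear_combination (-((q ^ (x + 1))⁻¹ * (1 - c1 * c2 * q ^ (2 * x + 2)))
        * phi q (q * (c1 * c2)) x k) * this

def al (q c1 c2 c3 : ℂ) (N k : ℕ) : ℂ :=
  -((1 - q ^ N * (q ^ k)⁻¹) * (1 - c2 * q ^ (k + 1)) * (1 - c1 * c2 * c3 * q ^ (N + 2 + k)))

def be (q c2 c3 : ℂ) (N k : ℕ) : ℂ := -(q ^ N * (q ^ k)⁻¹ * (1 - c2 * c3 * q ^ (k + 2)))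

theorem rat_bw {q c1 c2 c3 : ℂ} {N x : ℕ} (hq : q ≠ 0) (h : 1 - c1 * c2 * q ^ (2 * x + 1) ≠ 0)
    (k : ℕ) :
    Dt q c1 c2 c3 N x * (1 - (q ^ x)⁻¹ * q ^ k)
      - Bt q c1 c2 c3 N x * (1 - c1 * c2 * q ^ (x + 1) * q ^ k)
     = al q c1 c2 c3 N k + be q c2 c3 N k * (1 - (q ^ x)⁻¹ * q ^ k)
        * (1 - c1 * c2 * q ^ (x + 1) * q ^ k) := by
  unfold Dt Bt al be
  have hX : q ^ x ≠ 0 := pow_ne_zero _ hq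
  have hK : q ^ k ≠ 0 := pow_ne_zero _ hq
  have e1 : q ^ (2 * x + 1) = q * (q ^ x) ^ 2 := by ring
  have e2 : q ^ (N + 2 + x) = q ^ 2 * q ^ N * q ^ x := by ring
  have e3 : q ^ (x + N + 1) = q * q ^ N * q ^ x := by ring
  have e4 : q ^ (N + 2 + k) = q ^ 2 * q ^ N * q ^ k := by ring
  rw [e1] at h ⊢
  rw [e2, e3, e4, pow_add q x 1, pow_add q N 1, pow_add q k 1, pow_add q k 2, pow_one]
  generalize q ^ x = X at *
  generalize q ^ k = K at *
  generalize q ^ N = Q at *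
  rw [div_mul_eq_mul_div, div_mul_eq_mul_div, ← sub_div, div_eq_iff h]
  field_simp
  ring

theorem phi_bw {q c1 c2 c3 : ℂ} {N x : ℕ} (hq : q ≠ 0) (h : 1 - c1 * c2 * q ^ (2 * x + 1) ≠ 0)
    (k : ℕ) :
    Dt q c1 c2 c3 N x * (1 - (q ^ x)⁻¹) * (poch q ((q ^ x)⁻¹ * q) k * poch q (c1 * c2 * q ^ (x + 1)) k)
      - Bt q c1 c2 c3 N x * (1 - c1 * c2 * q ^ (x + 1)) * phi q (c1 * (q * c2)) x k
     = al q c1 c2 c3 N k * phi q (c1 * c2) x k + be q c2 c3 N k * phi q (c1 * c2) x (k + 1) := by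
  have h1 := poch_shift q ((q ^ x)⁻¹) k
  have h2 := poch_shift q (c1 * c2 * q ^ (x + 1)) k
  have h3 := rat_bw (c3 := c3) (N := N) hq h k
  unfold phi
  rw [poch_succ, poch_succ]
  rw [show c1 * (q * c2) * q ^ (x + 1) = c1 * c2 * q ^ (x + 1) * q by ring]
  linear_combination Dt q c1 c2 c3 N x * poch q (c1 * c2 * q ^ (x + 1)) k * h1
    - Bt q c1 c2 c3 N x * poch q ((q ^ x)⁻¹) k * h2
    + poch q ((q ^ x)⁻¹) k * poch q (c1 * c2 * q ^ (x + 1)) k * h3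

theorem phi_bw_succ {q c1 c2 c3 : ℂ} {N x : ℕ} (hq : q ≠ 0)
    (h : 1 - c1 * c2 * q ^ (2 * (x + 1) + 1) ≠ 0) (k : ℕ) :
    Dt q c1 c2 c3 N (x + 1) * (1 - (q ^ (x + 1))⁻¹) * phi q (c1 * (q * c2)) x k
      - Bt q c1 c2 c3 N (x + 1) * (1 - c1 * c2 * q ^ (x + 1 + 1)) * phi q (c1 * (q * c2)) (x + 1) k
     = al q c1 c2 c3 N k * phi q (c1 * c2) (x + 1) k
       + be q c2 c3 N k * phi q (c1 * c2) (x + 1) (k + 1) := by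
  rw [← phi_bw hq h]
  congr 2
  unfold phi
  rw [show (q ^ (x + 1))⁻¹ * q = (q ^ x)⁻¹ by field_simp; ring,
    show c1 * (q * c2) * q ^ (x + 1) = c1 * c2 * q ^ (x + 1 + 1) by ring]

theorem phi_bw_zero {q c1 c2 c3 : ℂ} {N : ℕ} (hq : q ≠ 0)
    (h : 1 - c1 * c2 * q ^ (2 * 0 + 1) ≠ 0) (k : ℕ) :
      - (Bt q c1 c2 c3 N 0 * (1 - c1 * c2 * q ^ (0 + 1)) * phi q (c1 * (q * c2)) 0 k)
     = al q c1 c2 c3 N k * phi q (c1 * c2) 0 k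
       + be q c2 c3 N k * phi q (c1 * c2) 0 (k + 1) := by
  rw [← phi_bw hq h]
  simp

theorem rr_al {q c1 c2 c3 : ℂ} {N : ℕ} (h : Gen q c1 c2 c3 (N + 1)) (n k : ℕ) (hk : k ≤ n)
    (hn : n ≤ N) :
    rr q c1 (q * c2) (q * c3) N n (k + 1) * al q c1 c2 c3 (N + 1) (k + 1)
      = rr q c1 (q * c2) (q * c3) N n k * (1 - (q ^ n)⁻¹ * q ^ k) * (1 - c2 * c3 * q ^ (n + k + 3))
        * (q ^ (N + 1) * (q ^ k)⁻¹) / (1 - q ^ (k + 1)) := by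
  have hq := h.q0
  unfold rr al
  have e1 : 1 - q * (q * c2) * q ^ k = 1 - c2 * q ^ (k + 1 + 1) := by ring
  have e2 : 1 - c1 * (q * c2) * (q * c3) * q ^ (N + 2) * q ^ k
      = 1 - c1 * c2 * c3 * q ^ (N + 1 + 2 + (k + 1)) := by ring
  have e3 : 1 - q * c2 * (q * c3) * q ^ (n + 1) * q ^ k = 1 - c2 * c3 * q ^ (n + k + 3) := by ring
  have e4 : 1 - q * q ^ k = 1 - q ^ (k + 1) := by ring
  rw [poch_succ, poch_succ, poch_succ, poch_succ, poch_succ, poch_succ, e1, e2, e3, e4]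
  rcases Nat.lt_or_ge k N with hkN | hkN
  · have a1 := h.g2 (k + 1 + 1) (by omega) (by omega)
    have a2 := h.g123 (N + 1 + 2 + (k + 1)) (by omega) (by omega)
    have a3 := h.gq (N - k) (by omega) (by omega)
    have hqk : q ^ k ≠ 0 := pow_ne_zero _ hq
    obtain ⟨d, rfl⟩ : ∃ d, N = k + d := ⟨N - k, by omega⟩
    rw [show k + d - k = d by omega] at a3
    rw [show (q ^ (k + d))⁻¹ * q ^ k = (q ^ d)⁻¹ by rw [pow_add]; field_simp,
      show q ^ (k + d + 1) * (q ^ (k + 1))⁻¹ = q ^ d by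
        rw [show q ^ (k + d + 1) = q ^ d * q ^ (k + 1) by ring]; field_simp,
      show q ^ (k + d + 1) * (q ^ k)⁻¹ = q ^ d * q by
        rw [show q ^ (k + d + 1) = q ^ d * q * q ^ k by ring]; field_simp]
    have hqd : q ^ d ≠ 0 := pow_ne_zero _ hq
    rw [show 1 - (q ^ d)⁻¹ = -(1 - q ^ d) * (q ^ d)⁻¹ by field_simp; ring, pow_succ q k]
    generalize poch q _ k = z1
    generalize poch q _ k = z2
    generalize poch q _ k = z3
    generalize poch q _ k = z4
    generalize poch q _ k = z5
    generalize poch q _ k = z6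
    generalize 1 - (q ^ n)⁻¹ * q ^ k = y1
    generalize 1 - q ^ k * q = y2
    generalize 1 - c2 * c3 * q ^ (n + k + 3) = y3
    generalize 1 - c2 * q ^ (k + 1 + 1) = y4 at *
    generalize 1 - c1 * c2 * c3 * q ^ (k + d + 1 + 2 + (k + 1)) = y5 at *
    generalize q ^ d = w at *
    generalize q ^ k = v at *
    field_simp
  · obtain rfl : n = k := by omega
    rw [show (q ^ n)⁻¹ * q ^ n = 1 by field_simp]
    simp

theorem rr_bw {q c1 c2 c3 : ℂ} {N : ℕ} (h : Gen q c1 c2 c3 (N + 1)) (n k : ℕ) (hk : k ≤ n)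
    (hn : n ≤ N) :
    rr q c1 (q * c2) (q * c3) N n (k + 1) * al q c1 c2 c3 (N + 1) (k + 1)
      + rr q c1 (q * c2) (q * c3) N n k * be q c2 c3 (N + 1) k
      = al q c1 c2 c3 (N + 1) 0 * rr q c1 c2 c3 (N + 1) (n + 1) (k + 1) := by
  have hq := h.q0
  have a8 := h.gq (k + 1) (by omega) (by omega)
  have a9 := h.gq (N + 1) (by omega) (by omega)
  have a10 := h.g2 1 (by omega) (by omega)
  have a11 := h.g123 (N + 3) (by omega) (by omega)
  rw [rr_al h n k hk hn]
  have := rr_fwd h n k (by omega)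
  rw [← eq_div_iff a8] at this
  rw [this]
  unfold al be
  generalize rr q c1 (q * c2) (q * c3) N n k = r
  have hK : q ^ k ≠ 0 := pow_ne_zero _ hq
  have hn : q ^ n ≠ 0 := pow_ne_zero _ hq
  have hN : q ^ (N + 1) ≠ 0 := pow_ne_zero _ hq
  rw [show 1 - (q ^ (N + 1))⁻¹ = -(1 - q ^ (N + 1)) * (q ^ (N + 1))⁻¹ by field_simp; ring]
  rw [show 1 - q * c2 = 1 - c2 * q ^ 1 by ring]
  rw [show N + 1 + 2 + 0 = N + 3 by ring, show 0 + 1 = 1 by ring, pow_zero, inv_one, mul_one]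
  generalize 1 - c2 * q ^ 1 = y1 at *
  generalize 1 - c1 * c2 * c3 * q ^ (N + 3) = y2 at *
  generalize q ^ (N + 1) = Q at *
  rw [show q ^ (n + k + 3) = q ^ 3 * q ^ n * q ^ k by ring, pow_add q n 1, pow_add q n 2,
    pow_add q k 2]
  rw [pow_add q k 1, pow_one] at *
  generalize q ^ k = K at *
  generalize q ^ n = M at *
  field_simp
  ring

theorem rr_zero (q c1 c2 c3 : ℂ) (N n : ℕ) : rr q c1 c2 c3 N n 0 = 1 := by
  simp [rr, poch_zero]

theorem rr_top {q : ℂ} (hq : q ≠ 0) (c1 c2 c3 : ℂ) (N n : ℕ) : rr q c1 c2 c3 N n (n + 1) = 0 := by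
  have : q ^ n ≠ 0 := pow_ne_zero _ hq
  simp [rr, poch_succ, this]

theorem RR_comb {q c1 c2 c3 : ℂ} {N : ℕ} (h : Gen q c1 c2 c3 (N + 1)) (n : ℕ) (hn : n ≤ N)
    (f : ℕ → ℂ) :
    ∑ k ∈ Finset.range (n + 1), rr q c1 (q * c2) (q * c3) N n k *
      (al q c1 c2 c3 (N + 1) k * f k + be q c2 c3 (N + 1) k * f (k + 1))
     = al q c1 c2 c3 (N + 1) 0 * ∑ k ∈ Finset.range (n + 2), rr q c1 c2 c3 (N + 1) (n + 1) k * f k := by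
  have e : ∑ k ∈ Finset.range (n + 1), rr q c1 (q * c2) (q * c3) N n k * (al q c1 c2 c3 (N + 1) k * f k)
     = ∑ k ∈ Finset.range (n + 2), rr q c1 (q * c2) (q * c3) N n k * (al q c1 c2 c3 (N + 1) k * f k) := by
    rw [Finset.sum_range_succ _ (n + 1), rr_top h.q0]
    simp
  simp only [mul_add]
  rw [Finset.sum_add_distrib, e, Finset.sum_range_succ' _ (n + 1), Finset.sum_range_succ' _ (n + 1),
    rr_zero, rr_zero, mul_add, Finset.mul_sum, add_right_comm, ← Finset.sum_add_distrib]
  congr 1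
  · apply Finset.sum_congr rfl
    intro k hk
    have hk := Finset.mem_range.1 hk
    have := rr_bw h n k (by omega) hn
    linear_combination f (k + 1) * this
  · ring

theorem RR_bw_succ {q c1 c2 c3 : ℂ} {N : ℕ} (h : Gen q c1 c2 c3 (N + 1)) (n x : ℕ) (hn : n ≤ N)
    (hx : x ≤ N) :
    al q c1 c2 c3 (N + 1) 0 * RR q c1 c2 c3 (N + 1) (n + 1) (x + 1)
    = Dt q c1 c2 c3 (N + 1) (x + 1) * (1 - (q ^ (x + 1))⁻¹) * RR q c1 (q * c2) (q * c3) N n x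
      - Bt q c1 c2 c3 (N + 1) (x + 1) * (1 - c1 * c2 * q ^ (x + 1 + 1))
        * RR q c1 (q * c2) (q * c3) N n (x + 1) := by
  unfold RR
  rw [← RR_comb h n hn, Finset.mul_sum, Finset.mul_sum, ← Finset.sum_sub_distrib]
  apply Finset.sum_congr rfl
  intro k _
  rw [← phi_bw_succ h.q0 (h.g12 _ (by omega) (by omega))]
  ring

theorem RR_bw_zero {q c1 c2 c3 : ℂ} {N : ℕ} (h : Gen q c1 c2 c3 (N + 1)) (n : ℕ) (hn : n ≤ N) :
    al q c1 c2 c3 (N + 1) 0 * RR q c1 c2 c3 (N + 1) (n + 1) 0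
    = - (Bt q c1 c2 c3 (N + 1) 0 * (1 - c1 * c2 * q ^ (0 + 1))
        * RR q c1 (q * c2) (q * c3) N n 0) := by
  unfold RR
  rw [← RR_comb h n hn, Finset.mul_sum, ← Finset.sum_neg_distrib]
  apply Finset.sum_congr rfl
  intro k _
  rw [← phi_bw_zero h.q0 (h.g12 _ (by omega) (by omega))]
  ring

theorem sbp (f G W : ℕ → ℂ) (M : ℕ) (h0 : W 0 = -G 0) (hs : ∀ x < M, W (x + 1) = G x - G (x + 1)) :
    ∑ x ∈ Finset.range (M + 1), W x * f x
      = ∑ x ∈ Finset.range M, G x * (f (x + 1) - f x) - G M * f M := by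
  induction M with
  | zero => simp [h0]
  | succ M ih =>
    rw [Finset.sum_range_succ, ih (fun x hx => hs x (by omega)), hs M (by omega),
      Finset.sum_range_succ]
    ring

theorem adj {q c1 c2 c3 : ℂ} {N : ℕ} (h : Gen q c1 c2 c3 (N + 1)) (n : ℕ) (hn : n ≤ N)
    (f : ℕ → ℂ) :
    al q c1 c2 c3 (N + 1) 0 * ∑ x ∈ Finset.range (N + 1 + 1),
      ww q c3 c2 c1 (N + 1) x * RR q c1 c2 c3 (N + 1) (n + 1) x * f x
    = ∑ x ∈ Finset.range (N + 1), vv q c1 c2 c3 (N + 1) x * RR q c1 (q * c2) (q * c3) N n x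
        * (f (x + 1) - f x) := by
  have := sbp f (fun x => vv q c1 c2 c3 (N + 1) x * RR q c1 (q * c2) (q * c3) N n x)
    (fun x => al q c1 c2 c3 (N + 1) 0 * (ww q c3 c2 c1 (N + 1) x * RR q c1 c2 c3 (N + 1) (n + 1) x))
    (N + 1) ?_ ?_
  · simp only [vv_top h.q0, zero_mul, sub_zero] at this
    rw [← this, Finset.mul_sum]
    apply Finset.sum_congr rfl
    intros; ring
  · have := RR_bw_zero h n hn
    simp only [vv]
    linear_combination ww q c3 c2 c1 (N + 1) 0 * this
  · intro x hx
    have := RR_bw_succ h n x hn (by omega)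
    rw [vv_eq h x (by omega)]
    simp only [vv]
    linear_combination ww q c3 c2 c1 (N + 1) (x + 1) * this

theorem al_ne {q c1 c2 c3 : ℂ} {N : ℕ} (h : Gen q c1 c2 c3 (N + 1)) :
    al q c1 c2 c3 (N + 1) 0 ≠ 0 := by
  have a1 := h.gq (N + 1) (by omega) (by omega)
  have a2 := h.g2 (0 + 1) (by omega) (by omega)
  have a3 := h.g123 (N + 1 + 2 + 0) (by omega) (by omega)
  unfold al
  rw [pow_zero, inv_one, mul_one]
  exact neg_ne_zero.2 (mul_ne_zero (mul_ne_zero a1 a2) a3)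

theorem RR_n0 (q c1 c2 c3 : ℂ) (N x : ℕ) : RR q c1 c2 c3 N 0 x = 1 := by
  simp [RR, rr_zero, phi, poch_zero]

theorem orth0 {q c1 c2 c3 : ℂ} {N : ℕ} (h : Gen q c1 c2 c3 (N + 1)) (n : ℕ) (hn : n ≤ N) :
    ∑ x ∈ Finset.range (N + 1 + 1),
      ww q c3 c2 c1 (N + 1) x * RR q c1 c2 c3 (N + 1) (n + 1) x = 0 := by
  have := adj h n hn (fun _ => 1)
  simp only [sub_self, mul_zero, Finset.sum_const_zero, mul_one] at this
  exact (mul_eq_zero.1 this).resolve_left (al_ne h)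

theorem ww_zero {q c1 c2 c3 : ℂ} {N : ℕ} (h : Gen q c1 c2 c3 N) :
    ww q c1 c2 c3 N 0 = poch q (q * c1) N / poch q (c2 * c3 * q ^ 2) N := by
  have a1 := h.g23 1 (by omega) (by omega)
  have a2 := pq_ne h N le_rfl
  rw [pow_one] at a1
  unfold ww
  simp only [poch_zero, Nat.sub_zero, poch_succ', mul_zero, zero_add, pow_one, pow_zero]
  rw [show c2 * c3 * q * q = c2 * c3 * q ^ 2 by ring]
  generalize poch q _ _ = z1 at *
  generalize poch q _ _ = z2 at *
  field_simp

theorem total (q : ℂ) (N : ℕ) : ∀ c1 c2 c3 : ℂ, Gen q c1 c2 c3 N →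
    ∑ x ∈ Finset.range (N + 1), ww q c3 c2 c1 N x
      = poch q (c2 * c3 * q ^ 2) N / ((q * c2) ^ N * poch q (q * c1) N) := by
  induction N with
  | zero =>
    intro c1 c2 c3 h
    have a1 := h.g12 1 (by omega) (by omega)
    simp [ww_zero h.symm, poch_zero]
  | succ N ih =>
    intro c1 c2 c3 h
    have h1 := orth0 h 0 (by omega)
    have h2 := ih _ _ _ h.s12
    have hq := h.q0
    simp only [RR, Finset.sum_range_succ _ (0 + 1), Finset.sum_range_succ _ 0, Finset.range_zero,
      Finset.sum_empty, rr_zero, zero_add] at h1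
    have p0 : ∀ x, phi q (c1 * c2) x 0 = 1 := by intro x; simp [phi, poch_zero]
    have p1 : ∀ x, phi q (c1 * c2) x 1 = (1 - (q ^ x)⁻¹) * (1 - c1 * c2 * q ^ (x + 1)) := by
      intro x; simp [phi, poch]
    simp only [p0, p1, mul_one, mul_add, Finset.sum_add_distrib] at h1
    rw [eq_neg_of_add_eq_zero_left h1, Finset.sum_range_succ']
    have a1 := h.gq (N + 1) (by omega) (by omega)
    have a2 := h.g1 1 (by omega) (by omega)
    have a3 := h.g2 1 (by omega) (by omega)
    have a4 := h.g123 (N + 3) (by omega) (by omega)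
    have a5 := h.gq 1 (by omega) (by omega)
    have a6 := h.c20
    have a7 := p1_ne h.s12 N (by omega)
    have e : ∀ x ∈ Finset.range (N + 1), ww q c3 c2 c1 (N + 1) (x + 1) * (rr q c1 c2 c3 (N + 1) 1 1 *
         ((1 - (q ^ (x + 1))⁻¹) * (1 - c1 * c2 * q ^ (x + 1 + 1)))) =
       (rr q c1 c2 c3 (N + 1) 1 1 * -((1 - q ^ (N + 1)) * (1 - c2 * q ^ 1) *
        (1 - c1 * c2 * c3 * q ^ (N + 3)) / ((1 - c1 * q ^ 1) * q ^ 2 * c2))) *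
         ww q c3 (q * c2) (q * c1) N x := by
      intro x hx
      have hx := Finset.mem_range.1 hx
      rw [ww_succ h.symm x (by omega)]
      have b1 := h.gq (x + 1) (by omega) (by omega)
      have b2 := h.g12 (x + 2) (by omega) (by omega)
      have b3 : q ^ x ≠ 0 := pow_ne_zero _ hq
      rw [show 1 - (q ^ (x + 1))⁻¹ = -(1 - q ^ (x + 1)) * (q ^ x)⁻¹ * q⁻¹ by field_simp; ring,
        show 1 - q * c2 = 1 - c2 * q ^ 1 by ring, show 1 - q * c1 = 1 - c1 * q ^ 1 by ring,
        show c2 * c1 = c1 * c2 by ring, show c3 * c2 * c1 = c1 * c2 * c3 by ring,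
        show x + 1 + 1 = x + 2 by ring]
      generalize 1 - c1 * c2 * q ^ (x + 2) = y1 at *
      generalize 1 - q ^ (x + 1) = y2 at *
      generalize 1 - q ^ (N + 1) = y3 at *
      generalize 1 - c1 * q ^ 1 = y4 at *
      generalize q ^ x = y5 at *
      field_simp
    rw [Finset.sum_congr rfl e, ← Finset.mul_sum, h2]
    simp only [rr, pow_zero, inv_one, sub_self, zero_mul, mul_zero, add_zero]
    rw [poch_succ' q (c2 * c3 * q ^ 2) N, poch_succ' q (q * c1),
      show c2 * c3 * q ^ 2 * q = q * c2 * c3 * q ^ 2 by ring,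
      show q * c1 * q = q * (q * c1) by ring,
      show (q * (q * c2)) ^ N = q ^ N * (q * c2) ^ N by ring]
    simp only [poch_succ' _ _ 0, poch_zero, mul_one]
    have b3 : q ^ N ≠ 0 := pow_ne_zero _ hq
    rw [show 1 - (q ^ (N + 1))⁻¹ = -(1 - q ^ (N + 1)) * (q ^ N)⁻¹ * q⁻¹ by field_simp; ring]
    rw [show 1 - q * c2 = 1 - c2 * q ^ 1 by ring, show 1 - q * c1 = 1 - c1 * q ^ 1 by ring,
      show 1 - (q ^ 1)⁻¹ = -(1 - q ^ 1) * q⁻¹ by field_simp; ring, pow_succ (q * c2),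
      show N + 1 + 2 = N + 3 by ring, show 1 - q = 1 - q ^ 1 by ring]
    generalize hw : (q * c2) ^ N = w
    have hw0 : w ≠ 0 := by rw [← hw]; exact pow_ne_zero _ (mul_ne_zero hq a6)
    generalize poch q _ N = z1 at *
    generalize poch q _ N = z2 at *
    generalize 1 - q ^ (N + 1) = y3 at *
    generalize 1 - c1 * q ^ 1 = y4 at *
    generalize 1 - c2 * q ^ 1 = y5 at *
    generalize 1 - c1 * c2 * c3 * q ^ (N + 3) = y6 at *
    generalize 1 - q ^ 1 = y7 at *
    generalize q ^ N = y8 at *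
    field_simp
    ring

theorem main (q : ℂ) (N : ℕ) : ∀ c1 c2 c3 : ℂ, Gen q c1 c2 c3 N → ∀ n m : ℕ, n ≤ N → m ≤ N →
    ∑ x ∈ Finset.range (N + 1), ww q c3 c2 c1 N x * RR q c1 c2 c3 N n x * RR q c1 c2 c3 N m x
      = if n = m then 1 / ((q * c2) ^ N * ww q c1 c2 c3 N n) else 0 := by
  induction N with
  | zero =>
    intro c1 c2 c3 h n m hn hm
    obtain rfl : n = 0 := by omega
    obtain rfl : m = 0 := by omega
    simp [RR_n0, ww_zero h, ww_zero h.symm, poch_zero]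
  | succ N ih =>
    intro c1 c2 c3 h n m hn hm
    rcases n with _ | n
    · rcases m with _ | m
      · simp only [RR_n0, mul_one, if_true]
        rw [total q (N + 1) _ _ _ h, ww_zero h]
        have := p1_ne h (N + 1) (by omega)
        have := h.q0
        have := h.c20
        field_simp
      · simp only [RR_n0, mul_one]
        rw [orth0 h m (by omega), if_neg (by omega)]
    · rcases m with _ | m
      · simp only [RR_n0, mul_one]
        rw [orth0 h n (by omega), if_neg (by omega)]
      · have h1 := adj h n (by omega) (RR q c1 c2 c3 (N + 1) (m + 1))
        have hq := h.q0
        have e : ∀ x ∈ Finset.range (N + 1),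
          vv q c1 c2 c3 (N + 1) x * RR q c1 (q * c2) (q * c3) N n x *
           (RR q c1 c2 c3 (N + 1) (m + 1) (x + 1) - RR q c1 c2 c3 (N + 1) (m + 1) x)
          = (-((1 - (q ^ (m + 1))⁻¹) * (1 - c2 * c3 * q ^ (m + 2)) * q / ((1 - q * c2)
        * (1 - c1 * c2 * c3 * q ^ (N + 3)) * (1 - (q ^ (N + 1))⁻¹))) * q⁻¹ *
         ((1 - q ^ (N + 1)) * (1 - q * c2) * (1 - c1 * c2 * c3 * q ^ (N + 3)) * (1 - q * c3))) *
          (ww q (q * c3) (q * c2) c1 N x * RR q c1 (q * c2) (q * c3) N n x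
            * RR q c1 (q * c2) (q * c3) N m x) := by
          intro x hx
          have hx := Finset.mem_range.1 hx
          rw [RR_fwd h m x (by omega)]
          have h2 := vv_ww h x (by omega)
          rw [show (q ^ (x + 1))⁻¹ = q⁻¹ * (q ^ x)⁻¹ by field_simp; ring]
          generalize -((1 - (q ^ (m + 1))⁻¹) * (1 - c2 * c3 * q ^ (m + 2)) * q / ((1 - q * c2)
            * (1 - c1 * c2 * c3 * q ^ (N + 3)) * (1 - (q ^ (N + 1))⁻¹))) = K
          linear_combination K * q⁻¹ * RR q c1 (q * c2) (q * c3) N n x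
            * RR q c1 (q * c2) (q * c3) N m x * h2
        rw [Finset.sum_congr rfl e, ← Finset.mul_sum, ih _ _ _ h.s23 n m (by omega) (by omega)] at h1
        apply mul_left_cancel₀ (al_ne h)
        rw [h1]
        by_cases hnm : n = m
        · subst hnm
          rw [if_pos rfl, if_pos rfl, ww_succ h n (by omega)]
          have a1 := h.gq (N + 1) (by omega) (by omega)
          have a2 := h.gq (n + 1) (by omega) (by omega)
          have a3 := h.g2 1 (by omega) (by omega)
          have a4 := h.g3 1 (by omega) (by omega)
          have a5 := h.g23 (n + 2) (by omega) (by omega)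
          have a6 := h.g123 (N + 3) (by omega) (by omega)
          have a7 := ww_ne h.s23 n (by omega)
          have a8 := h.c20
          have b1 : q ^ n ≠ 0 := pow_ne_zero _ hq
          have b2 : q ^ N ≠ 0 := pow_ne_zero _ hq
          unfold al
          rw [show 1 - (q ^ (N + 1))⁻¹ = -(1 - q ^ (N + 1)) * (q ^ N)⁻¹ * q⁻¹ by field_simp; ring,
            show 1 - (q ^ (n + 1))⁻¹ = -(1 - q ^ (n + 1)) * (q ^ n)⁻¹ * q⁻¹ by field_simp; ring,
            show 1 - q * c2 = 1 - c2 * q ^ 1 by ring, show 1 - q * c3 = 1 - c3 * q ^ 1 by ring,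
            show N + 1 + 2 + 0 = N + 3 by ring, show 0 + 1 = 1 by ring, pow_zero, inv_one, mul_one,
            show (q * (q * c2)) ^ N = q ^ N * (q * c2) ^ N by ring, pow_succ (q * c2)]
          generalize hw : (q * c2) ^ N = w
          have hw0 : w ≠ 0 := by rw [← hw]; exact pow_ne_zero _ (mul_ne_zero hq a8)
          generalize ww q c1 (q * c2) (q * c3) N n = z at *
          generalize 1 - q ^ (N + 1) = y1 at *
          generalize 1 - q ^ (n + 1) = y2 at *
          generalize 1 - c2 * q ^ 1 = y3 at *
          generalize 1 - c3 * q ^ 1 = y4 at *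
          generalize 1 - c2 * c3 * q ^ (n + 2) = y5 at *
          generalize 1 - c1 * c2 * c3 * q ^ (N + 3) = y6 at *
          generalize q ^ n = y7 at *
          generalize q ^ N = y8 at *
          field_simp
        · rw [if_neg hnm, if_neg (by omega)]
          simp

theorem Om_eq {q s c1 c2 c3 t2 : ℂ} {N : ℕ} (hq : q ≠ 0) (hc2 : c2 ≠ 0) (hs : s ^ 2 = q)
    (ht2 : t2 ^ 2 = c2) (n : ℕ) (hn : n ≤ N) :
    Om q s c1 c2 c3 t2 (N : ℤ) (n : ℤ) = (s * t2) ^ N * ww q c1 c2 c3 N n := by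
  unfold Om ww binom
  rw [if_pos ⟨by positivity, by exact_mod_cast hn⟩]
  have hu : (s * t2) ≠ 0 := by
    intro h0
    apply mul_ne_zero hq hc2
    rw [← hs, ← ht2, ← mul_pow, h0]; simp
  have e1 : ((N : ℤ) - (n : ℤ)).toNat = N - n := by omega
  have e2 : ((N : ℤ) + 1).toNat = N + 1 := by omega
  have e3 : (s * t2) ^ (2 * (n : ℤ) - (N : ℤ)) = (q * c2) ^ n / (s * t2) ^ N := by
    rw [zpow_sub₀ hu, zpow_mul, zpow_natCast, zpow_natCast]
    congr 2
    rw [← hs, ← ht2, ← mul_pow]; rfl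
  have e4 : q ^ (2 * (n : ℤ) + 1) = q ^ (2 * n + 1) := by exact_mod_cast zpow_natCast q (2 * n + 1)
  have e5 : q ^ ((n : ℤ) + 1) = q ^ (n + 1) := by exact_mod_cast zpow_natCast q (n + 1)
  have e6 : q ^ ((N : ℤ) + 2) = q ^ (N + 2) := by exact_mod_cast zpow_natCast q (N + 2)
  rw [e1, e2, e3, e4, e5, e6, Int.toNat_natCast, Int.toNat_natCast]
  simp only [div_eq_mul_inv, mul_inv, inv_inv]
  ring

theorem p_eq {q s c1 c2 c3 t2 : ℂ} {N : ℕ} (hq : q ≠ 0) (hc2 : c2 ≠ 0) (hs : s ^ 2 = q)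
    (ht2 : t2 ^ 2 = c2) (n x : ℕ) (hn : n ≤ N) (hx : x ≤ N) :
    p q s c1 c2 c3 t2 (N : ℤ) (n : ℤ) (x : ℤ)
      = (s * t2) ^ N * ww q c1 c2 c3 N n * RR q c1 c2 c3 N n x := by
  unfold p
  rw [if_pos ⟨by positivity, by exact_mod_cast hn, by positivity, by exact_mod_cast hx⟩,
    Om_eq hq hc2 hs ht2 n hn]
  congr 1
  unfold RR rr phi
  rw [Int.toNat_natCast]
  apply Finset.sum_congr rfl
  intro k _
  have e4 : q ^ ((x : ℤ) + 1) = q ^ (x + 1) := by exact_mod_cast zpow_natCast q (x + 1)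
  have e5 : q ^ ((n : ℤ) + 1) = q ^ (n + 1) := by exact_mod_cast zpow_natCast q (n + 1)
  have e6 : q ^ ((N : ℤ) + 2) = q ^ (N + 2) := by exact_mod_cast zpow_natCast q (N + 2)
  rw [e4, e5, e6]
  simp only [zpow_neg, zpow_natCast]
  ring

theorem gen_aux {q c : ℂ} (hq : q ≠ 0) (k : ℕ) (h : c ≠ q ^ (-(k : ℤ))) : 1 - c * q ^ k ≠ 0 := by
  contrapose! h
  rw [zpow_neg, zpow_natCast, ← one_div, eq_div_iff (pow_ne_zero _ hq)]
  linear_combination -h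

end qR

/-- Orthogonality of the normalized q-Racah polynomials. -/
theorem qRacah_orthogonality
    (N : ℕ) (q s c1 c2 c3 t1 t2 t3 : ℂ)
    (hq : q ≠ 0) (hc1 : c1 ≠ 0) (hc2 : c2 ≠ 0) (hc3 : c3 ≠ 0)
    (hs : s ^ 2 = q) (ht1 : t1 ^ 2 = c1) (ht2 : t2 ^ 2 = c2) (ht3 : t3 ^ 2 = c3)
    (hgen : ∀ e1 e2 e3 : ℕ, e1 ≤ 1 → e2 ≤ 1 → e3 ≤ 1 → 1 ≤ e1 + e2 + e3 →
      ∀ k : ℤ, 1 ≤ k → k ≤ 2 * (N : ℤ) + 5 → c1 ^ e1 * c2 ^ e2 * c3 ^ e3 ≠ q ^ (-k))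
    (hq1 : ∀ k : ℕ, 1 ≤ k → k ≤ N → q ^ k ≠ 1)
    (n m : ℤ) (hn0 : 0 ≤ n) (hnN : n ≤ (N : ℤ)) (hm0 : 0 ≤ m) (hmN : m ≤ (N : ℤ)) :
    ∑ x ∈ Finset.range (N + 1),
        qR.Om q s c3 c2 c1 t2 (N : ℤ) (x : ℤ) * qR.p q s c1 c2 c3 t2 (N : ℤ) n (x : ℤ)
          * qR.p q s c1 c2 c3 t2 (N : ℤ) m (x : ℤ)
      = (if n = m then 1 else 0) * qR.Om q s c1 c2 c3 t2 (N : ℤ) n := by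
  have hG : qR.Gen q c1 c2 c3 N := by
    have key : ∀ e1 e2 e3 : ℕ, e1 ≤ 1 → e2 ≤ 1 → e3 ≤ 1 → 1 ≤ e1 + e2 + e3 →
        ∀ k : ℕ, 1 ≤ k → k ≤ 2 * N + 5 → 1 - c1 ^ e1 * c2 ^ e2 * c3 ^ e3 * q ^ k ≠ 0 := by
      intro e1 e2 e3 h1 h2 h3 h4 k hk1 hk2
      exact qR.gen_aux hq k (hgen e1 e2 e3 h1 h2 h3 h4 k (by omega) (by omega))
    refine ⟨hq, hc2, ?_, ?_, ?_, ?_, ?_, ?_, ?_⟩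
    · simpa using key 1 0 0
    · simpa using key 0 1 0
    · simpa using key 0 0 1
    · simpa using key 1 1 0
    · simpa using key 0 1 1
    · simpa using key 1 1 1
    · intro k h1 h2 h3
      exact hq1 k h1 h2 (by linear_combination -h3)
  obtain ⟨n, rfl⟩ := Int.eq_ofNat_of_zero_le hn0
  obtain ⟨m, rfl⟩ := Int.eq_ofNat_of_zero_le hm0
  have hn : n ≤ N := by omega
  have hm : m ≤ N := by omega
  have hM := qR.main q N c1 c2 c3 hG n m hn hm
  have hu : (s * t2) ^ N * (s * t2) ^ N = (q * c2) ^ N := by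
    rw [← hs, ← ht2]; ring
  have e : ∀ x ∈ Finset.range (N + 1),
      qR.Om q s c3 c2 c1 t2 (N : ℤ) (x : ℤ) * qR.p q s c1 c2 c3 t2 (N : ℤ) n (x : ℤ)
          * qR.p q s c1 c2 c3 t2 (N : ℤ) m (x : ℤ)
      = ((q * c2) ^ N * (s * t2) ^ N * qR.ww q c1 c2 c3 N n * qR.ww q c1 c2 c3 N m) *
        (qR.ww q c3 c2 c1 N x * qR.RR q c1 c2 c3 N n x * qR.RR q c1 c2 c3 N m x) := by
    intro x hx
    have hx := Finset.mem_range.1 hx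
    rw [qR.Om_eq hq hc2 hs ht2 x (by omega), qR.p_eq hq hc2 hs ht2 n x hn (by omega),
      qR.p_eq hq hc2 hs ht2 m x hm (by omega), ← hu]
    ring
  rw [Finset.sum_congr rfl e, ← Finset.mul_sum, hM, qR.Om_eq hq hc2 hs ht2 n hn]
  by_cases hnm : n = m
  · subst hnm
    have a1 := qR.ww_ne hG n hn
    have a2 : (q * c2) ^ N ≠ 0 := pow_ne_zero _ (mul_ne_zero hq hc2)
    rw [if_pos rfl, if_pos rfl]
    generalize (q * c2) ^ N = w at *
    field_simp
  · rw [if_neg hnm, if_neg (by exact_mod_cast hnm)]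
    simp
end
end

section
/- Contiguity recurrence relations for the normalized q-Racah polynomials: for each choice of sign σ ∈ {+,−} and all integers n, x with 0 ≤ n ≤ N and 0 ≤ x ≤ N, one has λ_σ(x;c₁,c₂,c₃;N)·p_n(x;c₁,c₂,c₃;N+σ1) = Σ_{ε∈{−1,0,+1}} Φ_σ^{ε}(n+ε;c₁,c₂,c₃;N)·p_{n+ε}(x;c₁,c₂,c₃;N), where the superscript ε of Φ_σ is +, 0, − according as ε = +1, 0, −1, and p with a negative degree index is 0. -/
noncomputable section
namespace qRx
open qR

/-- Shifted q-Pochhammer symbol `(qa;q)_m`, extended to negative `m`. -/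
def F (q a : ℂ) (m : ℤ) : ℂ := if 0 ≤ m then poch q (q * a) m.toNat else (1 - a)⁻¹

theorem poch_succ (q a : ℂ) (k : ℕ) : poch q a (k + 1) = poch q a k * (1 - a * q ^ k) := by
  unfold poch; rw [Finset.prod_range_succ]

theorem poch_zero (q a : ℂ) : poch q a 0 = 1 := by simp [poch]

theorem poch_add (q a : ℂ) (n k : ℕ) :
    poch q (q * a) (n + k) = poch q (q * a) n * poch q (a * q ^ (n + 1)) k := by
  unfold poch
  rw [Finset.prod_range_add]
  congr 1
  apply Finset.prod_congr rfl
  intro i _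
  ring

theorem F_nat (q a : ℂ) (m : ℕ) : F q a m = poch q (q * a) m := by simp [F]

theorem F_one_neg (q : ℂ) (m : ℤ) (h : m < 0) : F q 1 m = 0 := by
  unfold F; rw [if_neg (by omega)]; simp

/-- step, `m ≥ 0`. -/
theorem F_step (q a : ℂ) (m : ℤ) (hm : 0 ≤ m) (h : 1 - a * q ^ m ≠ 0) :
    F q a m = F q a (m - 1) * (1 - a * q ^ m) := by
  rcases hm.eq_or_lt with h0 | h0
  · subst h0
    simp only [zpow_zero, mul_one] at h
    simp [F, poch_zero, h]
  · obtain ⟨k, rfl⟩ : ∃ k : ℕ, m = k + 1 := ⟨(m - 1).toNat, by omega⟩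
    have e1 : F q a ((k : ℤ) + 1) = poch q (q * a) (k + 1) := by
      rw [← F_nat]; push_cast; rfl
    rw [e1, add_sub_cancel_right, F_nat, poch_succ]
    congr 1
    have : q ^ ((k : ℤ) + 1) = q ^ (k + 1) := by exact_mod_cast zpow_natCast q (k + 1)
    rw [this]; ring

theorem F_up (q a : ℂ) (m : ℤ) (hm : 0 ≤ m + 1) (h : 1 - a * q ^ (m + 1) ≠ 0) :
    F q a (m + 1) = F q a m * (1 - a * q ^ (m + 1)) := by
  have := F_step q a (m + 1) hm h
  rwa [add_sub_cancel_right] at this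

theorem F_dn (q a : ℂ) (m : ℤ) (hm : 0 ≤ m) (h : 1 - a * q ^ m ≠ 0) :
    F q a (m - 1) = F q a m * (1 - a * q ^ m)⁻¹ := by
  rw [F_step q a m hm h, mul_assoc, mul_inv_cancel₀ h, mul_one]

/-- reciprocal of `(q;q)_m`, step valid for all integers. -/
theorem I_dn (q : ℂ) (m : ℤ) (h : 1 ≤ m → 1 - q ^ m ≠ 0) :
    (F q 1 (m - 1))⁻¹ = (1 - q ^ m) * (F q 1 m)⁻¹ := by
  rcases lt_trichotomy m 0 with h0 | h0 | h0
  · rw [F_one_neg q m h0, F_one_neg q _ (by omega)]; simp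
  · subst h0; rw [F_one_neg q _ (by omega)]; simp
  · have h1 := h (by omega)
    rw [F_step q 1 m (by omega) (by simpa using h1), one_mul, mul_inv]
    field_simp

theorem F_ne (q a : ℂ) (m : ℤ) (hm : 0 ≤ m) (h : ∀ j : ℤ, 1 ≤ j → j ≤ m → 1 - a * q ^ j ≠ 0) :
    F q a m ≠ 0 := by
  obtain ⟨k, rfl⟩ := Int.eq_ofNat_of_zero_le hm
  rw [F_nat]
  unfold poch
  rw [Finset.prod_ne_zero_iff]
  intro i hi
  rw [Finset.mem_range] at hi
  have := h (i + 1) (by omega) (by omega)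
  have e : q ^ ((i : ℤ) + 1) = q ^ (i + 1) := by exact_mod_cast zpow_natCast q (i + 1)
  rw [e] at this
  intro h0; apply this; rw [← h0]; ring

/-- coefficient of `B_k` in `p_n(.;N)`. -/
def H (q c1 c2 c3 w : ℂ) (N n k : ℤ) : ℂ :=
  q ^ (k * (N - n + 1)) * F q 1 (N - k) * (F q 1 (n - k))⁻¹ * (F q 1 (N - n))⁻¹
    * (1 - c2 * c3 * q ^ (2 * n + 1)) * F q c2 n * F q (c1 * c2 * c3) (N + 1 + n)
    * F q c1 (N - n) * F q (c2 * c3) (n + k) * w ^ (N - 2 * n)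
    * (F q (c1 * c2 * c3) (N + 1 + k))⁻¹ * (F q (c2 * c3) (n + N + 1))⁻¹
    * (F q c3 n)⁻¹ * (F q c2 k)⁻¹ * (F q 1 k)⁻¹

def Bk (q c1 c2 : ℂ) (x : ℤ) (k : ℕ) : ℂ :=
  poch q (q ^ (-x)) k * poch q (c1 * c2 * q ^ (x + 1)) k

theorem rev (q : ℂ) (hq : q ≠ 0) (n k : ℕ) (hk : k ≤ n) :
    poch q (q ^ (-(n : ℤ))) k * poch q q (n - k)
      = poch q q n * (∏ l ∈ Finset.range k, (-q ^ l)) * q ^ (-(n * k : ℤ)) := by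
  induction k with
  | zero => simp [poch_zero]
  | succ k ih =>
    have ih' := ih (by omega)
    obtain ⟨m, rfl⟩ : ∃ m, n = k + 1 + m := ⟨n - (k + 1), by omega⟩
    have e1 : k + 1 + m - (k + 1) = m := by omega
    have e2 : k + 1 + m - k = m + 1 := by omega
    rw [e2, poch_succ q q m] at ih'
    rw [e1, poch_succ, Finset.prod_range_succ]
    have h1 : q ^ (-((k + 1 + m : ℕ) : ℤ)) * q ^ k * q ^ (m + 1) = 1 := by
      rw [← zpow_natCast, ← zpow_natCast, ← zpow_add₀ hq, ← zpow_add₀ hq]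
      push_cast
      rw [show -((k : ℤ) + 1 + m) + k + (m + 1) = 0 by ring, zpow_zero]
    have h2 : q ^ (-((k + 1 + m : ℕ) * (k + 1 : ℕ) : ℤ))
        = q ^ (-((k + 1 + m : ℕ) * k : ℤ)) * q ^ (-((k + 1 + m : ℕ) : ℤ)) := by
      rw [← zpow_add₀ hq]; congr 1; push_cast; ring
    rw [h2]
    set U := q ^ (-((k + 1 + m : ℕ) : ℤ))
    set V := q ^ (-((k + 1 + m : ℕ) * k : ℤ))
    have h3 : q * q ^ m = q ^ (m + 1) := by ring
    rw [h3] at ih'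
    linear_combination (-U * q ^ k) * ih' - (poch q U k * poch q q m) * h1

theorem prod_ne (q : ℂ) (hq : q ≠ 0) (k : ℕ) : (∏ l ∈ Finset.range k, (-q ^ l)) ≠ 0 := by
  rw [Finset.prod_ne_zero_iff]; intro i _; simp [hq]

theorem pochq_ne (q : ℂ) (m : ℕ) (h : ∀ j : ℕ, 1 ≤ j → j ≤ m → q ^ j ≠ 1) : poch q q m ≠ 0 := by
  unfold poch
  rw [Finset.prod_ne_zero_iff]
  intro i hi
  rw [Finset.mem_range] at hi
  have := h (i + 1) (by omega) (by omega)
  intro h0; apply this; linear_combination -h0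

theorem aux5 (L R a b c d e : ℂ) (ha : a = 1) (hb : b = 1) (hc : c = 1) (hd : d = 1) (he : e = 1)
    (h : L * a * b = R * c * d * e) : L = R := by
  subst ha hb hc hd he; simpa using h

set_option maxHeartbeats 1000000 in
theorem term_eq (q s c1 c2 c3 t2 : ℂ) (hq : q ≠ 0) (hw : s * t2 ≠ 0) (N n k : ℕ)
    (hk : k ≤ n) (hn : n ≤ N)
    (g0 : ∀ j : ℕ, 1 ≤ j → j ≤ N → q ^ j ≠ 1)
    (gC : ∀ j : ℤ, 1 ≤ j → j ≤ 2 * N + 1 → 1 - c1 * c2 * c3 * q ^ j ≠ 0)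
    (gd : ∀ j : ℤ, 1 ≤ j → j ≤ 2 * N + 1 → 1 - c2 * c3 * q ^ j ≠ 0) (X : ℂ) :
    Om q s c1 c2 c3 t2 N n * (poch q (q ^ (-(n : ℤ))) k * poch q (c2 * c3 * q ^ ((n : ℤ) + 1)) k * X * q ^ k
          / (poch q (q * c2) k * poch q (c1 * c2 * c3 * q ^ ((N : ℤ) + 2)) k
              * poch q (q ^ (-(N : ℤ))) k * poch q q k)) = H q c1 c2 c3 (s * t2) N n k * X := by
  have z1 : q ^ ((n : ℤ) + 1) = q ^ (n + 1) := by exact_mod_cast zpow_natCast q (n + 1)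
  have z2 : q ^ ((N : ℤ) + 2) = q ^ (N + 1 + 1) := by exact_mod_cast zpow_natCast q (N + 2)
  have hb : binom q N n = poch q q N / (poch q q n * poch q q (N - n)) := by
    unfold binom
    rw [if_pos (by omega)]
    congr 3
    omega
  have t1 : (((N : ℤ) - n)).toNat = N - n := by omega
  have t2' : (((N : ℤ) + 1)).toNat = N + 1 := by omega
  have k1 : F q 1 ((N : ℤ) - k) = poch q q (N - k) := by
    rw [show (N : ℤ) - k = ((N - k : ℕ) : ℤ) by omega, F_nat, mul_one]
  have k2 : F q 1 ((n : ℤ) - k) = poch q q (n - k) := by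
    rw [show (n : ℤ) - k = ((n - k : ℕ) : ℤ) by omega, F_nat, mul_one]
  have k3 : F q 1 ((N : ℤ) - n) = poch q q (N - n) := by
    rw [show (N : ℤ) - n = ((N - n : ℕ) : ℤ) by omega, F_nat, mul_one]
  have k4 : F q c1 ((N : ℤ) - n) = poch q (q * c1) (N - n) := by
    rw [show (N : ℤ) - n = ((N - n : ℕ) : ℤ) by omega, F_nat]
  have k5 : F q (c1 * c2 * c3) ((N : ℤ) + 1 + n) = F q (c1 * c2 * c3) ((N : ℤ) + 1) *
      poch q (c1 * c2 * c3 * q ^ (N + 1 + 1)) n := by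
    rw [show (N : ℤ) + 1 + n = ((N + 1 + n : ℕ) : ℤ) by push_cast; ring, F_nat, poch_add, ← F_nat]
    push_cast; rfl
  have k6 : F q (c1 * c2 * c3) ((N : ℤ) + 1 + k) = F q (c1 * c2 * c3) ((N : ℤ) + 1) *
      poch q (c1 * c2 * c3 * q ^ (N + 1 + 1)) k := by
    rw [show (N : ℤ) + 1 + k = ((N + 1 + k : ℕ) : ℤ) by push_cast; ring, F_nat, poch_add, ← F_nat]
    push_cast; rfl
  have k7 : F q (c2 * c3) ((n : ℤ) + k) = F q (c2 * c3) n * poch q (c2 * c3 * q ^ (n + 1)) k := by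
    rw [show (n : ℤ) + k = ((n + k : ℕ) : ℤ) by push_cast; ring, F_nat, poch_add, ← F_nat]
  have k8 : F q (c2 * c3) ((n : ℤ) + N + 1) = F q (c2 * c3) n * poch q (c2 * c3 * q ^ (n + 1)) (N + 1) := by
    rw [show (n : ℤ) + N + 1 = ((n + (N + 1) : ℕ) : ℤ) by push_cast; ring, F_nat, poch_add, ← F_nat]
  have k9 : F q 1 (k : ℤ) = poch q q k := by rw [F_nat, mul_one]
  have nC : F q (c1 * c2 * c3) ((N : ℤ) + 1) ≠ 0 := by
    by_cases hN : N = 0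
    · subst hN
      apply F_ne _ _ _ (by omega); intro j h1 h2; exact gC j h1 (by push_cast at h2 ⊢; omega)
    · apply F_ne _ _ _ (by omega); intro j h1 h2; exact gC j h1 (by omega)
  have nd : F q (c2 * c3) (n : ℤ) ≠ 0 := by
    apply F_ne _ _ _ (by omega); intro j h1 h2; exact gd j h1 (by omega)
  have m1 : poch q q N ≠ 0 := pochq_ne q N g0
  have m2 : poch q q n ≠ 0 := pochq_ne q n (fun j a b => g0 j a (by omega))
  have m3 : poch q q (n - k) ≠ 0 := pochq_ne q _ (fun j a b => g0 j a (by omega))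
  have m4 : poch q q (N - k) ≠ 0 := pochq_ne q _ (fun j a b => g0 j a (by omega))
  have r1 := rev q hq n k hk
  have r2 := rev q hq N k (by omega)
  have pn := prod_ne q hq k
  have u1 : poch q (q ^ (-(n : ℤ))) k = poch q q n * (∏ l ∈ Finset.range k, (-q ^ l)) * q ^ (-(n * k : ℤ)) * (poch q q (n - k))⁻¹ := by
    rw [← r1]; field_simp
  have u2 : (poch q (q ^ (-(N : ℤ))) k)⁻¹ = (poch q q N)⁻¹ * (∏ l ∈ Finset.range k, (-q ^ l))⁻¹ * q ^ ((N * k : ℤ)) * (poch q q (N - k)) := by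
    have : poch q (q ^ (-(N : ℤ))) k = poch q q N * (∏ l ∈ Finset.range k, (-q ^ l)) * q ^ (-(N * k : ℤ)) * (poch q q (N - k))⁻¹ := by
      rw [← r2]; field_simp
    rw [this, mul_inv, mul_inv, mul_inv, ← zpow_neg, inv_inv, neg_neg]
  have u3 : q ^ ((k : ℤ) * ((N : ℤ) - n + 1)) = q ^ ((N * k : ℤ)) * q ^ (-(n * k : ℤ)) * q ^ k := by
    rw [← zpow_natCast q k, ← zpow_add₀ hq, ← zpow_add₀ hq]; congr 1; ring
  have u4 : (s * t2) ^ ((N : ℤ) - 2 * n) = ((s * t2) ^ (2 * (n : ℤ) - N))⁻¹ := by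
    rw [← zpow_neg]; congr 1; ring
  unfold Om H
  rw [hb, t1, t2', k1, k2, k3, k4, k5, k6, k7, k8, k9, F_nat q c2 n, F_nat q c3 n, F_nat q c2 k, z1, z2, u3, u4]
  simp only [Int.toNat_natCast, div_eq_mul_inv, mul_inv]
  rw [u2, u1]
  set P := ∏ l ∈ Finset.range k, (-q ^ l)
  set FC := F q (c1 * c2 * c3) ((N : ℤ) + 1)
  set Fd := F q (c2 * c3) (n : ℤ)
  have v1 : P * P⁻¹ = 1 := mul_inv_cancel₀ pn
  have v2 : FC * FC⁻¹ = 1 := mul_inv_cancel₀ nC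
  have v3 : Fd * Fd⁻¹ = 1 := mul_inv_cancel₀ nd
  have v4 : poch q q N * (poch q q N)⁻¹ = 1 := mul_inv_cancel₀ m1
  have v5 : poch q q n * (poch q q n)⁻¹ = 1 := mul_inv_cancel₀ m2
  generalize P⁻¹ = iP at *
  generalize FC⁻¹ = iFC at *
  generalize Fd⁻¹ = iFd at *
  generalize (poch q q N)⁻¹ = iN at *
  generalize (poch q q n)⁻¹ = i_n at *
  exact aux5 _ _ _ _ _ _ _ v2 v3 v1 v4 v5 (by ring)

theorem H_zero (q c1 c2 c3 w : ℂ) (N n k : ℤ) (h : n < k ∨ N < n) : H q c1 c2 c3 w N n k = 0 := by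
  unfold H
  rcases h with h | h
  · rw [F_one_neg q (n - k) (by omega)]; simp
  · rw [F_one_neg q (N - n) (by omega)]; simp

theorem p_eq (q s c1 c2 c3 t2 : ℂ) (hq : q ≠ 0) (hw : s * t2 ≠ 0) (N n x : ℤ) (m : ℕ)
    (hx : 0 ≤ x) (hxN : x ≤ N) (hm : n < m)
    (g0 : ∀ j : ℕ, 1 ≤ j → (j : ℤ) ≤ N → q ^ j ≠ 1)
    (gC : ∀ j : ℤ, 1 ≤ j → j ≤ 2 * N + 1 → 1 - c1 * c2 * c3 * q ^ j ≠ 0)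
    (gd : ∀ j : ℤ, 1 ≤ j → j ≤ 2 * N + 1 → 1 - c2 * c3 * q ^ j ≠ 0) :
    p q s c1 c2 c3 t2 N n x
      = ∑ k ∈ Finset.range m, H q c1 c2 c3 (s * t2) N n k * Bk q c1 c2 x k := by
  unfold p
  split_ifs with h
  · obtain ⟨h1, h2, -, -⟩ := h
    obtain ⟨n, rfl⟩ := Int.eq_ofNat_of_zero_le h1
    obtain ⟨N, rfl⟩ := Int.eq_ofNat_of_zero_le (h1.trans h2)
    have hs : Finset.range (n + 1) ⊆ Finset.range m := by
      intro i hi; rw [Finset.mem_range] at *; omega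
    rw [← Finset.sum_subset hs, Finset.mul_sum]
    · apply Finset.sum_congr (by simp)
      intro k hk
      rw [Finset.mem_range] at hk
      rw [← term_eq q s c1 c2 c3 t2 hq hw N n k (by omega) (by omega)
        (fun j a b => g0 j a (by omega)) gC gd]
      unfold Bk
      congr 2; ring
    · intro k _ hk
      rw [Finset.mem_range] at hk
      rw [H_zero _ _ _ _ _ _ _ _ (Or.inl (by omega)), zero_mul]
  · symm
    apply Finset.sum_eq_zero
    intro k _
    rw [H_zero, zero_mul]
    omega

theorem Bk_succ (q c1 c2 : ℂ) (hq : q ≠ 0) (x : ℤ) (k : ℕ) :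
    Bk q c1 c2 x (k + 1) = Bk q c1 c2 x k * ((1 - q ^ (-x) * q ^ k) * (1 - c1 * c2 * q ^ (x + 1) * q ^ k)) := by
  unfold Bk; rw [poch_succ, poch_succ]; ring

theorem Bk_zero (q c1 c2 : ℂ) (hq : q ≠ 0) (x : ℤ) (k : ℕ) (hx : 0 ≤ x) (hk : x < k) : Bk q c1 c2 x k = 0 := by
  unfold Bk
  obtain ⟨x, rfl⟩ := Int.eq_ofNat_of_zero_le hx
  have : poch q (q ^ (-(x : ℤ))) k = 0 := by
    unfold poch
    apply Finset.prod_eq_zero (i := x) (by rw [Finset.mem_range]; omega)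
    rw [zpow_neg, zpow_natCast, inv_mul_cancel₀ (pow_ne_zero _ hq), sub_self]
  rw [this, zero_mul]

/-- summation framework -/
theorem sum_frame (q c1 c2 lamx : ℂ) (hq : q ≠ 0) (n : ℕ) (x : ℤ) (l h r : ℤ → ℂ) (hx : 0 ≤ x) (N : ℕ) (hxN : x ≤ N)
    (hl : ∀ k : ℕ, lamx = l k - (q ^ k)⁻¹ * ((1 - q ^ (-x) * q ^ k) * (1 - c1 * c2 * q ^ (x + 1) * q ^ k)))
    (h0 : h (-1) = 0) (h1 : h (n + 1) = 0)
    (hr : ∀ k : ℕ, k ≤ n + 1 → k ≤ N → l k * h k - q / q ^ k * h ((k : ℤ) - 1) = r k) :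
    lamx * ∑ k ∈ Finset.range (n + 2), h k * Bk q c1 c2 x k
      = ∑ k ∈ Finset.range (n + 2), r k * Bk q c1 c2 x k := by
  have e1 : ∀ k ∈ Finset.range (n + 2), r k * Bk q c1 c2 x k
      = (l k * h k - q / q ^ k * h ((k : ℤ) - 1)) * Bk q c1 c2 x k := by
    intro k hk
    rw [Finset.mem_range] at hk
    by_cases hkN : k ≤ N
    · rw [hr k (by omega) hkN]
    · rw [Bk_zero q c1 c2 hq x k hx (by omega)]; simp
  have e2 : ∀ k ∈ Finset.range (n + 2), lamx * (h k * Bk q c1 c2 x k)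
      = l k * h k * Bk q c1 c2 x k - (q ^ k)⁻¹ * h k * Bk q c1 c2 x (k + 1) := by
    intro k _
    rw [Bk_succ q c1 c2 hq, hl k]; ring
  rw [Finset.sum_congr rfl e1, Finset.mul_sum, Finset.sum_congr rfl e2]
  simp only [sub_mul]
  rw [Finset.sum_sub_distrib, Finset.sum_sub_distrib]
  congr 1
  rw [Finset.sum_range_succ, Finset.sum_range_succ' _ (n + 1)]
  have : h ((n + 1 : ℕ) : ℤ) = 0 := by push_cast; exact h1
  have h0' : h (((0 : ℕ) : ℤ) - 1) = 0 := by simpa using h0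
  rw [this, h0']
  simp only [mul_zero, zero_mul, add_zero]
  apply Finset.sum_congr rfl
  intro k _
  have hqk : q ^ k ≠ 0 := pow_ne_zero _ hq
  push_cast
  rw [add_sub_cancel_right, pow_succ]
  field_simp


structure Gen (q c1 c2 c3 : ℂ) (N : ℤ) : Prop where
  hq : q ≠ 0
  h1 : c1 ≠ 0
  h2 : c2 ≠ 0
  h3 : c3 ≠ 0
  g0 : ∀ m : ℤ, 1 ≤ m → m ≤ N + 1 → 1 - q ^ m ≠ 0
  g1 : ∀ m : ℤ, 0 ≤ m → m ≤ 2 * N + 5 → 1 - c1 * q ^ m ≠ 0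
  g2 : ∀ m : ℤ, 0 ≤ m → m ≤ 2 * N + 5 → 1 - c2 * q ^ m ≠ 0
  g3 : ∀ m : ℤ, 0 ≤ m → m ≤ 2 * N + 5 → 1 - c3 * q ^ m ≠ 0
  gd : ∀ m : ℤ, 0 ≤ m → m ≤ 2 * N + 5 → 1 - c2 * c3 * q ^ m ≠ 0
  gC : ∀ m : ℤ, 0 ≤ m → m ≤ 2 * N + 5 → 1 - c1 * c2 * c3 * q ^ m ≠ 0

def D (q c1 c2 c3 w : ℂ) (N n k : ℤ) : ℂ :=
  q ^ (k * (N - n + 1)) * F q 1 (N - k) * (F q 1 (n - k + 1))⁻¹ * (F q 1 (N - n + 1))⁻¹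
    * F q c2 n * F q (c1 * c2 * c3) (N + 1 + n)
    * F q c1 (N - n) * F q (c2 * c3) (n + k) * w ^ (N - 2 * n)
    * (F q (c1 * c2 * c3) (N + 1 + k))⁻¹ * (F q (c2 * c3) (n + N + 1))⁻¹
    * (F q c3 n)⁻¹ * (F q c2 k)⁻¹ * (F q 1 k)⁻¹

theorem I_dn' (q : ℂ) (m : ℤ) (h : 1 ≤ m + 1 → 1 - q ^ (m + 1) ≠ 0) :
    (F q 1 m)⁻¹ = (1 - q ^ (m + 1)) * (F q 1 (m + 1))⁻¹ := by
  have := I_dn q (m + 1) h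
  rwa [add_sub_cancel_right] at this

theorem R0 {q c1 c2 c3 : ℂ} (w : ℂ) {N : ℤ} (g : Gen q c1 c2 c3 N) (n k : ℤ) (hn : 0 ≤ n) (hnN : n ≤ N)
    (hk : 0 ≤ k) :
    H q c1 c2 c3 w N n k = (1 - q ^ (n - k + 1)) * (1 - q ^ (N - n + 1))
      * (1 - c2 * c3 * q ^ (2 * n + 1)) * D q c1 c2 c3 w N n k := by
  unfold H D
  rw [I_dn' q (n - k) (fun h => g.g0 _ h (by omega)), I_dn' q (N - n) (fun h => g.g0 _ h (by omega))]
  ring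

theorem RP {q c1 c2 c3 : ℂ} (w : ℂ) (hw : w ≠ 0) {N : ℤ} (g : Gen q c1 c2 c3 N) (n k : ℤ) (hn : 0 ≤ n)
    (hnN : n ≤ N) (hk : 0 ≤ k) (hkN : k ≤ N) :
    H q c1 c2 c3 w N (n + 1) k = (q ^ k)⁻¹ * (1 - q ^ (N - n)) * (1 - q ^ (N - n + 1))
      * (1 - c2 * c3 * q ^ (2 * (n + 1) + 1)) * (1 - c2 * q ^ (n + 1))
      * (1 - c1 * c2 * c3 * q ^ (N + 1 + n + 1)) * (1 - c1 * q ^ (N - n))⁻¹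
      * (1 - c2 * c3 * q ^ (n + k + 1)) * (w ^ 2)⁻¹ * (1 - c2 * c3 * q ^ (n + N + 1 + 1))⁻¹
      * (1 - c3 * q ^ (n + 1))⁻¹ * D q c1 c2 c3 w N n k := by
  unfold H D
  have e1 : q ^ (k * (N - (n + 1) + 1)) = q ^ (k * (N - n + 1)) * (q ^ k)⁻¹ := by
    rw [← zpow_neg, ← zpow_add₀ g.hq]; congr 1; ring
  have e2 : w ^ (N - 2 * (n + 1)) = w ^ (N - 2 * n) * (w ^ 2)⁻¹ := by
    rw [← zpow_natCast w 2, ← zpow_neg, ← zpow_add₀ hw]; congr 1; push_cast; ring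
  have e3 : N - (n + 1) = N - n - 1 := by ring
  rw [e1, e2, e3, show n + 1 - k = n - k + 1 by ring, show N + 1 + (n + 1) = N + 1 + n + 1 by ring,
    show n + 1 + k = n + k + 1 by ring, show n + 1 + N + 1 = n + N + 1 + 1 by ring,
    I_dn q (N - n) (fun h => g.g0 _ h (by omega)), I_dn' q (N - n) (fun h => g.g0 _ h (by omega)),
    F_up q c2 n (by omega) (g.g2 _ (by omega) (by omega)),
    F_up q (c1 * c2 * c3) (N + 1 + n) (by omega) (g.gC _ (by omega) (by omega)),
    F_dn q c1 (N - n) (by omega) (g.g1 _ (by omega) (by omega)),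
    F_up q (c2 * c3) (n + k) (by omega) (g.gd _ (by omega) (by omega)),
    F_up q (c2 * c3) (n + N + 1) (by omega) (g.gd _ (by omega) (by omega)),
    F_up q c3 n (by omega) (g.g3 _ (by omega) (by omega)), mul_inv, mul_inv]
  ring

theorem RM {q c1 c2 c3 : ℂ} (w : ℂ) (hw : w ≠ 0) {N : ℤ} (g : Gen q c1 c2 c3 N) (n k : ℤ) (hn : 0 ≤ n)
    (hnN : n ≤ N) (hk : 0 ≤ k) (hkN : k ≤ N) :
    H q c1 c2 c3 w N (n - 1) k = q ^ k * (1 - q ^ (n - k)) * (1 - q ^ (n - k + 1))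
      * (1 - c2 * c3 * q ^ (2 * (n - 1) + 1)) * (1 - c2 * q ^ n)⁻¹
      * (1 - c1 * c2 * c3 * q ^ (N + 1 + n))⁻¹ * (1 - c1 * q ^ (N - n + 1))
      * (1 - c2 * c3 * q ^ (n + k))⁻¹ * w ^ 2 * (1 - c2 * c3 * q ^ (n + N + 1))
      * (1 - c3 * q ^ n) * D q c1 c2 c3 w N n k := by
  unfold H D
  have e1 : q ^ (k * (N - (n - 1) + 1)) = q ^ (k * (N - n + 1)) * q ^ k := by
    rw [← zpow_add₀ g.hq]; congr 1; ring
  have e2 : w ^ (N - 2 * (n - 1)) = w ^ (N - 2 * n) * w ^ 2 := by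
    rw [← zpow_natCast w 2, ← zpow_add₀ hw]; congr 1; push_cast; ring
  have e3 : N - (n - 1) = N - n + 1 := by ring
  rw [e1, e2, e3, show n - 1 - k = n - k - 1 by ring, show N + 1 + (n - 1) = N + 1 + n - 1 by ring,
    show n - 1 + k = n + k - 1 by ring, show n - 1 + N + 1 = n + N + 1 - 1 by ring,
    I_dn q (n - k) (fun h => g.g0 _ h (by omega)), I_dn' q (n - k) (fun h => g.g0 _ h (by omega)),
    F_dn q c2 n (by omega) (g.g2 _ (by omega) (by omega)),
    F_dn q (c1 * c2 * c3) (N + 1 + n) (by omega) (g.gC _ (by omega) (by omega)),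
    F_up q c1 (N - n) (by omega) (g.g1 _ (by omega) (by omega)),
    F_dn q (c2 * c3) (n + k) (by omega) (g.gd _ (by omega) (by omega)),
    F_dn q (c2 * c3) (n + N + 1) (by omega) (g.gd _ (by omega) (by omega)),
    F_dn q c3 n (by omega) (g.g3 _ (by omega) (by omega)), mul_inv, mul_inv, inv_inv, inv_inv]
  ring

theorem RU {q c1 c2 c3 : ℂ} (w : ℂ) (hw : w ≠ 0) {N : ℤ} (g : Gen q c1 c2 c3 N) (n k : ℤ) (hn : 0 ≤ n)
    (hnN : n ≤ N) (hk : 0 ≤ k) (hkN : k ≤ N) :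
    H q c1 c2 c3 w (N + 1) n k = q ^ k * (1 - q ^ (N - k + 1)) * (1 - q ^ (n - k + 1))
      * (1 - c2 * c3 * q ^ (2 * n + 1)) * (1 - c1 * c2 * c3 * q ^ (N + 1 + n + 1))
      * (1 - c1 * q ^ (N - n + 1)) * w * (1 - c1 * c2 * c3 * q ^ (N + 1 + k + 1))⁻¹
      * (1 - c2 * c3 * q ^ (n + N + 1 + 1))⁻¹ * D q c1 c2 c3 w N n k := by
  unfold H D
  have e1 : q ^ (k * (N + 1 - n + 1)) = q ^ (k * (N - n + 1)) * q ^ k := by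
    rw [← zpow_add₀ g.hq]; congr 1; ring
  have e2 : w ^ (N + 1 - 2 * n) = w ^ (N - 2 * n) * w := by
    rw [← zpow_add_one₀ hw]; congr 1; ring
  rw [e1, e2, show N + 1 - n = N - n + 1 by ring, show N + 1 - k = N - k + 1 by ring,
    show N + 1 + 1 + n = N + 1 + n + 1 by ring, show N + 1 + 1 + k = N + 1 + k + 1 by ring,
    show n + (N + 1) + 1 = n + N + 1 + 1 by ring,
    F_up q 1 (N - k) (by omega) (by rw [one_mul]; exact g.g0 _ (by omega) (by omega)), one_mul,
    I_dn' q (n - k) (fun h => g.g0 _ h (by omega)),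
    F_up q (c1 * c2 * c3) (N + 1 + n) (by omega) (g.gC _ (by omega) (by omega)),
    F_up q (c1 * c2 * c3) (N + 1 + k) (by omega) (g.gC _ (by omega) (by omega)),
    F_up q c1 (N - n) (by omega) (g.g1 _ (by omega) (by omega)),
    F_up q (c2 * c3) (n + N + 1) (by omega) (g.gd _ (by omega) (by omega)), mul_inv, mul_inv]
  ring

theorem RUk {q c1 c2 c3 : ℂ} (w : ℂ) (hw : w ≠ 0) {N : ℤ} (g : Gen q c1 c2 c3 N) (n k : ℤ) (hn : 0 ≤ n)
    (hnN : n ≤ N) (hk : 0 ≤ k) (hkN : k ≤ N) :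
    H q c1 c2 c3 w (N + 1) n (k - 1) = q ^ k * (q ^ (N - n) * q ^ 2)⁻¹ * (1 - q ^ (N - k + 1))
      * (1 - q ^ (N - k + 1 + 1))
      * (1 - c2 * c3 * q ^ (2 * n + 1)) * (1 - c1 * c2 * c3 * q ^ (N + 1 + n + 1))
      * (1 - c1 * q ^ (N - n + 1)) * (1 - c2 * c3 * q ^ (n + k))⁻¹ * w
      * (1 - c2 * c3 * q ^ (n + N + 1 + 1))⁻¹ * (1 - c2 * q ^ k) * (1 - q ^ k)
      * D q c1 c2 c3 w N n k := by
  by_cases hk0 : k = 0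
  · subst hk0
    unfold H
    rw [F_one_neg q (0 - 1) (by norm_num)]; simp
  have hN2 : 1 - q ^ (N - k + 1 + 1) ≠ 0 := g.g0 _ (by omega) (by omega)
  unfold H D
  have e1 : q ^ ((k - 1) * (N + 1 - n + 1)) = q ^ (k * (N - n + 1)) * (q ^ k * (q ^ (N - n) * q ^ 2)⁻¹) := by
    rw [← zpow_natCast q 2, ← zpow_add₀ g.hq, ← zpow_neg, ← zpow_add₀ g.hq, ← zpow_add₀ g.hq]; congr 1; push_cast; ring
  have e2 : w ^ (N + 1 - 2 * n) = w ^ (N - 2 * n) * w := by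
    rw [← zpow_add_one₀ hw]; congr 1; ring
  rw [e1, e2, show N + 1 - n = N - n + 1 by ring, show N + 1 - (k - 1) = N - k + 1 + 1 by ring,
    show n - (k - 1) = n - k + 1 by ring, show n + (k - 1) = n + k - 1 by ring,
    show N + 1 + 1 + n = N + 1 + n + 1 by ring, show N + 1 + 1 + (k - 1) = N + 1 + k by ring,
    show n + (N + 1) + 1 = n + N + 1 + 1 by ring,
    F_up q 1 (N - k + 1) (by omega) (by rw [one_mul]; exact hN2),
    F_up q 1 (N - k) (by omega) (by rw [one_mul]; exact g.g0 _ (by omega) (by omega)), one_mul, one_mul,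
    F_up q (c1 * c2 * c3) (N + 1 + n) (by omega) (g.gC _ (by omega) (by omega)),
    F_up q c1 (N - n) (by omega) (g.g1 _ (by omega) (by omega)),
    F_dn q (c2 * c3) (n + k) (by omega) (g.gd _ (by omega) (by omega)),
    F_up q (c2 * c3) (n + N + 1) (by omega) (g.gd _ (by omega) (by omega)),
    F_dn q c2 k (by omega) (g.g2 _ (by omega) (by omega)),
    I_dn q k (fun h => g.g0 _ h (by omega))]
  simp only [mul_inv, inv_inv]
  ring

theorem RL {q c1 c2 c3 : ℂ} (w : ℂ) (hw : w ≠ 0) {N : ℤ} (g : Gen q c1 c2 c3 N) (n k : ℤ) (hn : 0 ≤ n)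
    (hnN : n ≤ N) (hk : 0 ≤ k) (hkN : k < N) :
    (1 - q ^ (N - k)) * H q c1 c2 c3 w (N - 1) n k = (q ^ k)⁻¹ * (1 - q ^ (n - k + 1))
      * (1 - q ^ (N - n)) * (1 - q ^ (N - n + 1))
      * (1 - c2 * c3 * q ^ (2 * n + 1)) * (1 - c1 * c2 * c3 * q ^ (N + 1 + n))⁻¹
      * (1 - c1 * q ^ (N - n))⁻¹ * w⁻¹ * (1 - c1 * c2 * c3 * q ^ (N + 1 + k))
      * (1 - c2 * c3 * q ^ (n + N + 1)) * D q c1 c2 c3 w N n k := by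
  unfold H D
  have e1 : q ^ (k * (N - 1 - n + 1)) = q ^ (k * (N - n + 1)) * (q ^ k)⁻¹ := by
    rw [← zpow_neg, ← zpow_add₀ g.hq]; congr 1; ring
  have e2 : w ^ (N - 1 - 2 * n) = w ^ (N - 2 * n) * w⁻¹ := by
    rw [← zpow_sub_one₀ hw]; congr 1; ring
  rw [e1, e2, show N - 1 - n = N - n - 1 by ring, show N - 1 - k = N - k - 1 by ring,
    show N - 1 + 1 + n = N + 1 + n - 1 by ring, show N - 1 + 1 + k = N + 1 + k - 1 by ring,
    show n + (N - 1) + 1 = n + N + 1 - 1 by ring,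
    F_step q 1 (N - k) (by omega) (by rw [one_mul]; exact g.g0 _ (by omega) (by omega)), one_mul,
    I_dn' q (n - k) (fun h => g.g0 _ h (by omega)),
    I_dn q (N - n) (fun h => g.g0 _ h (by omega)), I_dn' q (N - n) (fun h => g.g0 _ h (by omega)),
    F_dn q (c1 * c2 * c3) (N + 1 + n) (by omega) (g.gC _ (by omega) (by omega)),
    F_dn q (c1 * c2 * c3) (N + 1 + k) (by omega) (g.gC _ (by omega) (by omega)),
    F_dn q c1 (N - n) (by omega) (g.g1 _ (by omega) (by omega)),
    F_dn q (c2 * c3) (n + N + 1) (by omega) (g.gd _ (by omega) (by omega)), mul_inv, mul_inv,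
    inv_inv, inv_inv]
  ring

theorem RLk {q c1 c2 c3 : ℂ} (w : ℂ) (hw : w ≠ 0) {N : ℤ} (g : Gen q c1 c2 c3 N) (n k : ℤ) (hn : 0 ≤ n)
    (hnN : n ≤ N) (hk : 0 ≤ k) (hkN : k ≤ N) :
    H q c1 c2 c3 w (N - 1) n (k - 1) = (q ^ k * q ^ (N - n))⁻¹
      * (1 - q ^ (N - n)) * (1 - q ^ (N - n + 1))
      * (1 - c2 * c3 * q ^ (2 * n + 1)) * (1 - c1 * c2 * c3 * q ^ (N + 1 + n))⁻¹
      * (1 - c1 * q ^ (N - n))⁻¹ * (1 - c2 * c3 * q ^ (n + k))⁻¹ * w⁻¹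
      * (1 - c1 * c2 * c3 * q ^ (N + 1 + k)) * (1 - c1 * c2 * c3 * q ^ (N + k))
      * (1 - c2 * c3 * q ^ (n + N + 1)) * (1 - c2 * q ^ k) * (1 - q ^ k)
      * D q c1 c2 c3 w N n k := by
  unfold H D
  have e1 : q ^ ((k - 1) * (N - 1 - n + 1)) = q ^ (k * (N - n + 1)) * (q ^ k * q ^ (N - n))⁻¹ := by
    rw [← zpow_add₀ g.hq, ← zpow_neg, ← zpow_add₀ g.hq]; congr 1; ring
  have e2 : w ^ (N - 1 - 2 * n) = w ^ (N - 2 * n) * w⁻¹ := by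
    rw [← zpow_sub_one₀ hw]; congr 1; ring
  rw [e1, e2, show N - 1 - n = N - n - 1 by ring, show N - 1 - (k - 1) = N - k by ring,
    show n - (k - 1) = n - k + 1 by ring, show n + (k - 1) = n + k - 1 by ring,
    show N - 1 + 1 + n = N + 1 + n - 1 by ring, show N - 1 + 1 + (k - 1) = N + k - 1 by ring,
    show n + (N - 1) + 1 = n + N + 1 - 1 by ring,
    I_dn q (N - n) (fun h => g.g0 _ h (by omega)), I_dn' q (N - n) (fun h => g.g0 _ h (by omega)),
    F_dn q (c1 * c2 * c3) (N + 1 + n) (by omega) (g.gC _ (by omega) (by omega)),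
    F_dn q (c1 * c2 * c3) (N + k) (by omega) (g.gC _ (by omega) (by omega)),
    show N + k = N + 1 + k - 1 by ring,
    F_dn q (c1 * c2 * c3) (N + 1 + k) (by omega) (g.gC _ (by omega) (by omega)),
    F_dn q c1 (N - n) (by omega) (g.g1 _ (by omega) (by omega)),
    F_dn q (c2 * c3) (n + k) (by omega) (g.gd _ (by omega) (by omega)),
    F_dn q (c2 * c3) (n + N + 1) (by omega) (g.gd _ (by omega) (by omega)),
    F_dn q c2 k (by omega) (g.g2 _ (by omega) (by omega)),
    I_dn q k (fun h => g.g0 _ h (by omega))]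
  simp only [mul_inv, inv_inv]
  ring


theorem mon (q : ℂ) (hq : q ≠ 0) (N n k : ℤ) (K A B : ℂ) (hK : q ^ k = K) (hA : q ^ (n - k) = A)
    (hB : q ^ (N - n) = B) (e : ℤ) (i j l r : ℕ) (he : e = i * k + j * (n - k) + l * (N - n) + r := by push_cast; ring) :
    q ^ e = K ^ i * A ^ j * B ^ l * q ^ r := by
  subst hK hA hB
  rw [he, zpow_add₀ hq, zpow_add₀ hq, zpow_add₀ hq, mul_comm (i : ℤ), mul_comm (j : ℤ), mul_comm (l : ℤ),
    zpow_mul, zpow_mul, zpow_mul]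
  simp only [zpow_natCast]

def LP1 (q K A B c1 c2 c3 : ℂ) : ℂ :=
  -(1 - A*B*q*c3)*(K*q*c2)*(1-A*B*q)*(1-A*q)*(1-c2*c3*(K^2*A^2*q))*(1-c1*c2*c3*(K^2*A^2*B*q^2))*(1-c1*(B*q))*(1-c2*c3*(K^2*A))*((1-c2*c3*(K^2*A^2))*(1-c2*c3*(K^2*A^2*q^2)))
def LP2 (q K A B c1 c2 c3 : ℂ) : ℂ :=
  c3*K*A*c2*q*(1-A*B*q)*(1-A*B*q^2)*(1-c2*c3*(K^2*A^2*q))*(1-c1*c2*c3*(K^2*A^2*B*q^2))*(1-c1*(B*q))*(1-c2*K)*(1-K)*((1-c2*c3*(K^2*A^2))*(1-c2*c3*(K^2*A^2*q^2)))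
def RP1 (q K A B c1 c2 c3 : ℂ) : ℂ :=
  -c3*c2*K*A^2*q^2*(1-K*A*q)*(1-c1*(B*q))*(1-B*q)*(1-B)*(1-c2*(K*A*q))*(1-c1*c2*c3*(K^2*A^2*B*q^2))*(1-c2*c3*(K^2*A*q))*((1-c2*c3*(K^2*A^2))*(1-c2*c3*(K^2*A)))
def RP2 (q K A B c1 c2 c3 : ℂ) : ℂ :=
  (c3*c2^2*K^2*A^2*q*(1-K*A)*(1-c1*(B*q))*(1-c1*(B*q^2))*(1-c3*(K*A))*(1-c2*c3*(K^2*A^2*q^2))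
     + (1-c1*c2*c3*(K^2*A^2*B*q^2))*(1-c1*c2*c3*(K^2*A^2*B*q^3))*(1-c2*(K*A*q))*(1-c2*c3*(K*A*q))*(1-c2*c3*(K^2*A^2))
     - (1-c2*c3*(K^2*A^2*q))*(1-c1*c2*(K*A*B*q^2))*(1-c1*c2*c3*(K*A*B*q^2))*(1-c2*c3*(K^2*A^2))*(1-c2*c3*(K^2*A^2*q^2)))*(1-A*q)*(1-B*q)*((1-c2*c3*(K^2*A))*(1-c2*c3*(K^2*A^2*B*q^2)))
def RP3 (q K A B c1 c2 c3 : ℂ) : ℂ :=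
  -(K*q*c2*(1-A*q)*(1-A)*(1-c1*c2*c3*(K^2*A^2*B*q^2))*(1-c2*c3*(K*A))*(1-c1*(B*q))*(1-c2*c3*(K^2*A^2*B*q))*(1-c3*(K*A))*((1-c2*c3*(K^2*A^2*q^2))*(1-c2*c3*(K^2*A^2*B*q^2))))

def SP (q K A B c2 c3 w D : ℂ) : ℂ :=
  w * D * (c3*(K*A*B)*q^2*c2*((1-c2*c3*(K^2*A^2))*(1-c2*c3*(K^2*A^2*q^2))*(1-c2*c3*(K^2*A))*(1-c2*c3*(K^2*A^2*B*q^2))))⁻¹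

theorem tLP1 {q c1 c2 c3 : ℂ} (w : ℂ) (hw : w ≠ 0) {N : ℤ} (g : Gen q c1 c2 c3 N)
    (n k : ℤ) (hn : 0 ≤ n) (hnN : n ≤ N) (hk : 0 ≤ k) (hkN : k ≤ N)
    (K A B : ℂ) (hK : q ^ k = K) (hA : q ^ (n - k) = A) (hB : q ^ (N - n) = B) :
    lamP q c1 c2 c3 N k * H q c1 c2 c3 w (N + 1) n k
      = LP1 q K A B c1 c2 c3 * SP q K A B c2 c3 w (D q c1 c2 c3 w N n k) := by
  have hq := g.hq
  have h2 := g.h2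
  have h3 := g.h3
  have m := @mon q g.hq N n k K A B hK hA hB
  have nK : K ≠ 0 := hK ▸ zpow_ne_zero _ hq
  have nA : A ≠ 0 := hA ▸ zpow_ne_zero _ hq
  have nB : B ≠ 0 := hB ▸ zpow_ne_zero _ hq
  have m0 := m (2 * n) 2 2 0 0
  have m2 := m (2 * n + 2) 2 2 0 2
  have m4 := m (n + k) 2 1 0 0
  have m5 := m (n + N + 1 + 1) 2 2 1 2
  have d0 := g.gd (2 * n) (by omega) (by omega)
  have d2 := g.gd (2 * n + 2) (by omega) (by omega)
  have d4 := g.gd (n + k) (by omega) (by omega)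
  have d5 := g.gd (n + N + 1 + 1) (by omega) (by omega)
  have d6 := g.gC (N + 1 + k + 1) (by omega) (by omega)
  rw [RU w hw g n k hn hnN hk hkN]
  unfold lamP LP1 SP
  rw [show -N - 1 = -(N + 1) by ring, zpow_neg, zpow_neg, hK, m (N + 1) 1 1 1 1,
    m (N + k + 2) 2 1 1 2, m (N - k + 1) 0 1 1 1,
    m (n - k + 1) 0 1 0 1, m (2 * n + 1) 2 2 0 1,
    m (N + 1 + n + 1) 2 2 1 2, m (N - n + 1) 0 0 1 1,
    m (N + 1 + k + 1) 2 1 1 2, m5]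
  rw [m (N + 1 + k + 1) 2 1 1 2] at d6
  rw [m0] at d0
  rw [m2] at d2
  rw [m4] at d4
  rw [m5] at d5
  simp only [pow_zero, pow_one, mul_one, one_mul] at *
  generalize 1-c2*c3*(K^2*A^2) = e0 at *
  generalize 1-c2*c3*(K^2*A^2*q^2) = e2 at *
  generalize 1-c2*c3*(K^2*A) = e4 at *
  generalize 1-c2*c3*(K^2*A^2*B*q^2) = e5 at *
  generalize 1 - c1 * c2 * c3 * (K ^ 2 * A * B * q ^ 2) = e6 at *
  have hl : (K * A * B * q)⁻¹ / c3 - K⁻¹ = (1 - A * B * q * c3) * (K * A * B * q * c3)⁻¹ := by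
    field_simp
  rw [hl]
  generalize 1 - A * B * q * c3 = y1 at *
  generalize D q c1 c2 c3 w N n k = y2 at *
  generalize 1 - A * B * q = y3 at *
  generalize 1 - A * q = y3 at *
  generalize 1 - c2 * c3 * (K ^ 2 * A ^ 2 * q) = y4 at *
  generalize 1 - c1 * c2 * c3 * (K ^ 2 * A ^ 2 * B * q ^ 2) = y5 at *
  generalize 1 - c1 * (B * q) = y6 at *
  clear m m0 m2 m4 m5
  field_simp

theorem ctx {q c1 c2 c3 : ℂ} (w : ℂ) (hw : w ≠ 0) (hw2 : w ^ 2 = q * c2) {N : ℤ} (g : Gen q c1 c2 c3 N)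
    (n k : ℤ) (K A B : ℂ) (hK : q ^ k = K) (hA : q ^ (n - k) = A) (hB : q ^ (N - n) = B) :
    q ≠ 0 ∧ c2 ≠ 0 ∧ c3 ≠ 0 ∧ K ≠ 0 ∧ A ≠ 0 ∧ B ≠ 0 ∧ w⁻¹ = w * (q * c2)⁻¹ := by
  refine ⟨g.hq, g.h2, g.h3, hK ▸ zpow_ne_zero _ g.hq, hA ▸ zpow_ne_zero _ g.hq, hB ▸ zpow_ne_zero _ g.hq, ?_⟩
  rw [← hw2]; field_simp

theorem tLP2 {q c1 c2 c3 : ℂ} (w : ℂ) (hw : w ≠ 0) (hw2 : w ^ 2 = q * c2) {N : ℤ} (g : Gen q c1 c2 c3 N)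
    (n k : ℤ) (hn : 0 ≤ n) (hnN : n ≤ N) (hk : 0 ≤ k) (hkN : k ≤ N)
    (K A B : ℂ) (hK : q ^ k = K) (hA : q ^ (n - k) = A) (hB : q ^ (N - n) = B) :
    q / q ^ k * H q c1 c2 c3 w (N + 1) n (k - 1)
      = LP2 q K A B c1 c2 c3 * SP q K A B c2 c3 w (D q c1 c2 c3 w N n k) := by
  obtain ⟨hq, h2, h3, nK, nA, nB, hwi⟩ := ctx w hw hw2 g n k K A B hK hA hB
  have m := @mon q g.hq N n k K A B hK hA hB
  have d0 := g.gd (2 * n) (by omega) (by omega)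
  rw [m (2 * n) 2 2 0 0] at d0
  have d1 := g.gd (2 * n + 2) (by omega) (by omega)
  rw [m (2 * n + 2) 2 2 0 2] at d1
  have d2 := g.gd (n + k) (by omega) (by omega)
  rw [m (n + k) 2 1 0 0] at d2
  have d3 := g.gd (n + N + 1 + 1) (by omega) (by omega)
  rw [m (n + N + 1 + 1) 2 2 1 2] at d3
  rw [RUk w hw g n k hn hnN hk hkN]
  unfold LP2 SP
  rw [hK,
    hB,
    m (N - k + 1 + 1) 0 1 1 2,
    m (N - k + 1) 0 1 1 1,
    m (2 * n + 1) 2 2 0 1,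
    m (N + 1 + n + 1) 2 2 1 2,
    m (N - n + 1) 0 0 1 1,
    m (n + k) 2 1 0 0,
    m (n + N + 1 + 1) 2 2 1 2]
  clear m
  simp only [pow_zero, pow_one, mul_one, one_mul] at *
  generalize 1 - c2 * c3 * (K ^ 2 * A ^ 2) = y0 at *
  generalize 1 - c2 * c3 * (K ^ 2 * A ^ 2 * q ^ 2) = y1 at *
  generalize 1 - c2 * c3 * (K ^ 2 * A) = y2 at *
  generalize 1 - c2 * c3 * (K ^ 2 * A ^ 2 * B * q ^ 2) = y3 at *
  generalize 1 - c2 * c3 * (K ^ 2 * A ^ 2 * q) = y4 at *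
  generalize D q c1 c2 c3 w N n k = y5 at *
  generalize 1 - A * B * q = y6 at *
  generalize 1 - A * B * q ^ 2 = y7 at *
  generalize 1 - c1 * c2 * c3 * (K ^ 2 * A ^ 2 * B * q ^ 2) = y8 at *
  generalize 1 - c1 * (B * q) = y9 at *
  generalize 1 - c2 * K = y10 at *
  generalize 1 - K = y11 at *
  field_simp


theorem tRP1 {q c1 c2 c3 : ℂ} (w : ℂ) (hw : w ≠ 0) (hw2 : w ^ 2 = q * c2) {N : ℤ} (g : Gen q c1 c2 c3 N)
    (n k : ℤ) (hn : 0 ≤ n) (hnN : n ≤ N) (hk : 0 ≤ k) (hkN : k ≤ N)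
    (K A B : ℂ) (hK : q ^ k = K) (hA : q ^ (n - k) = A) (hB : q ^ (N - n) = B) :
    PhiPp q w c1 c2 c3 N (n + 1) * H q c1 c2 c3 w N (n + 1) k
      = RP1 q K A B c1 c2 c3 * SP q K A B c2 c3 w (D q c1 c2 c3 w N n k) := by
  obtain ⟨hq, h2, h3, nK, nA, nB, hwi⟩ := ctx w hw hw2 g n k K A B hK hA hB
  have m := @mon q g.hq N n k K A B hK hA hB
  have d0 := g.gd (2 * n) (by omega) (by omega)
  rw [m (2 * n) 2 2 0 0] at d0
  have d1 := g.gd (2 * n + 2) (by omega) (by omega)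
  rw [m (2 * n + 2) 2 2 0 2] at d1
  have d2 := g.gd (n + k) (by omega) (by omega)
  rw [m (n + k) 2 1 0 0] at d2
  have d3 := g.gd (n + N + 1 + 1) (by omega) (by omega)
  rw [m (n + N + 1 + 1) 2 2 1 2] at d3
  have d4 := g.gd (2 * n + 3) (by omega) (by omega)
  rw [m (2 * n + 3) 2 2 0 3] at d4
  have d5 := g.g1 (N - n) (by omega) (by omega)
  rw [m (N - n) 0 0 1 0] at d5
  have d6 := g.g3 (n + 1) (by omega) (by omega)
  rw [m (n + 1) 1 1 0 1] at d6
  have z : q ^ (2 * (n + 1) - N - 1) = K * A * q * B⁻¹ := by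
    rw [show 2 * (n + 1) - N - 1 = k + (n - k) + 1 + -(N - n) by ring, zpow_add₀ hq, zpow_add₀ hq, zpow_add₀ hq,
      zpow_neg, hK, hA, hB, zpow_one]
  rw [RP w hw g n k hn hnN hk hkN, hw2]
  unfold PhiPp RP1 SP
  rw [z,
    hK,
    m (2 * (n + 1) + 1) 2 2 0 3,
    m (2 * (n + 1)) 2 2 0 2,
    m (N - (n + 1) + 1) 0 0 1 0,
    m (N + 2 - (n + 1)) 0 0 1 1,
    hB,
    m (N - n + 1) 0 0 1 1,
    m (n + 1) 1 1 0 1,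
    m (N + 1 + n + 1) 2 2 1 2,
    m (n + k + 1) 2 1 0 1,
    m (n + N + 1 + 1) 2 2 1 2]
  clear m
  simp only [pow_zero, pow_one, mul_one, one_mul] at *
  generalize 1 - c2 * c3 * (K ^ 2 * A ^ 2) = y0 at *
  generalize 1 - c2 * c3 * (K ^ 2 * A ^ 2 * q ^ 2) = y1 at *
  generalize 1 - c2 * c3 * (K ^ 2 * A) = y2 at *
  generalize 1 - c2 * c3 * (K ^ 2 * A ^ 2 * B * q ^ 2) = y3 at *
  generalize 1 - c2 * c3 * (K ^ 2 * A ^ 2 * q ^ 3) = y4 at *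
  generalize D q c1 c2 c3 w N n k = y5 at *
  generalize 1 - c1 * B = y6 at *
  generalize 1 - c1 * (B * q) = y7 at *
  generalize 1 - c3 * (K * A * q) = y8 at *
  generalize 1 - K * A * q = y9 at *
  generalize 1 - B * q = y10 at *
  generalize 1 - B = y11 at *
  generalize 1 - c2 * (K * A * q) = y12 at *
  generalize 1 - c1 * c2 * c3 * (K ^ 2 * A ^ 2 * B * q ^ 2) = y13 at *
  generalize 1 - c2 * c3 * (K ^ 2 * A * q) = y14 at *
  field_simp


theorem tRP2 {q c1 c2 c3 : ℂ} (w : ℂ) (hw : w ≠ 0) (hw2 : w ^ 2 = q * c2) {N : ℤ} (g : Gen q c1 c2 c3 N)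
    (n k : ℤ) (hn : 0 ≤ n) (hnN : n ≤ N) (hk : 0 ≤ k) (hkN : k ≤ N)
    (K A B : ℂ) (hK : q ^ k = K) (hA : q ^ (n - k) = A) (hB : q ^ (N - n) = B) :
    PhiP0 q w c1 c2 c3 N n * H q c1 c2 c3 w N n k
      = RP2 q K A B c1 c2 c3 * SP q K A B c2 c3 w (D q c1 c2 c3 w N n k) := by
  obtain ⟨hq, h2, h3, nK, nA, nB, hwi⟩ := ctx w hw hw2 g n k K A B hK hA hB
  have m := @mon q g.hq N n k K A B hK hA hB
  have d0 := g.gd (2 * n) (by omega) (by omega)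
  rw [m (2 * n) 2 2 0 0] at d0
  have d1 := g.gd (2 * n + 1) (by omega) (by omega)
  rw [m (2 * n + 1) 2 2 0 1] at d1
  have d2 := g.gd (2 * n + 2) (by omega) (by omega)
  rw [m (2 * n + 2) 2 2 0 2] at d2
  have d3 := g.gd (n + k) (by omega) (by omega)
  rw [m (n + k) 2 1 0 0] at d3
  have d4 := g.gd (n + N + 1 + 1) (by omega) (by omega)
  rw [m (n + N + 1 + 1) 2 2 1 2] at d4
  have z : q ^ (2 * n - N - 1) = K * A * (B * q)⁻¹ := by
    rw [show 2 * n - N - 1 = k + (n - k) + -(N - n + 1) by ring, zpow_add₀ hq, zpow_add₀ hq,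
      zpow_neg, hK, hA, zpow_add₀ hq, hB, zpow_one]
  rw [R0 w g n k hn hnN hk]
  unfold PhiP0 PhiPp PhiPm RP2 SP
  rw [z,
    m (2 * n + 1) 2 2 0 1,
    m (2 * n + 2) 2 2 0 2,
    m (2 * n) 2 2 0 0,
    m (N - n + 1) 0 0 1 1,
    m (N + 2 - n) 0 0 1 2,
    m (n + 1) 1 1 0 1,
    m (n + N + 2) 2 2 1 2,
    m (n + N + 3) 2 2 1 3,
    m (N + 1) 1 1 1 1,
    m (N + 2) 1 1 1 2,
    m (n - k + 1) 0 1 0 1,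
    m (n) 1 1 0 0]
  clear m
  simp only [pow_zero, pow_one, mul_one, one_mul] at *
  generalize 1 - c2 * c3 * (K ^ 2 * A ^ 2) = y0 at *
  generalize 1 - c2 * c3 * (K ^ 2 * A ^ 2 * q) = y1 at *
  generalize 1 - c2 * c3 * (K ^ 2 * A ^ 2 * q ^ 2) = y2 at *
  generalize 1 - c2 * c3 * (K ^ 2 * A) = y3 at *
  generalize 1 - c2 * c3 * (K ^ 2 * A ^ 2 * B * q ^ 2) = y4 at *
  generalize D q c1 c2 c3 w N n k = y5 at *
  generalize 1 - c1 * (B * q) = y6 at *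
  generalize 1 - c1 * (B * q ^ 2) = y7 at *
  generalize 1 - c3 * (K * A) = y8 at *
  generalize 1 - K * A = y9 at *
  generalize 1 - c1 * c2 * c3 * (K ^ 2 * A ^ 2 * B * q ^ 2) = y10 at *
  generalize 1 - c1 * c2 * c3 * (K ^ 2 * A ^ 2 * B * q ^ 3) = y11 at *
  generalize 1 - c2 * (K * A * q) = y12 at *
  generalize 1 - c2 * c3 * (K * A * q) = y13 at *
  generalize 1 - c1 * c2 * (K * A * B * q ^ 2) = y14 at *
  generalize 1 - c1 * c2 * c3 * (K * A * B * q ^ 2) = y15 at *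
  generalize 1 - A * q = y16 at *
  generalize 1 - B * q = y17 at *
  simp only [div_eq_mul_inv, mul_inv, hwi]
  clear hwi
  field_simp
  ring


theorem tRP3' {q c1 c2 c3 : ℂ} (w : ℂ) (hw : w ≠ 0) (hw2 : w ^ 2 = q * c2) {N : ℤ} (g : Gen q c1 c2 c3 N)
    (n k : ℤ) (hn : 1 ≤ n) (hnN : n ≤ N) (hk : 0 ≤ k) (hkN : k ≤ N)
    (K A B : ℂ) (hK : q ^ k = K) (hA : q ^ (n - k) = A) (hB : q ^ (N - n) = B) :
    PhiPm q w c1 c2 c3 N (n - 1) * H q c1 c2 c3 w N (n - 1) k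
      = RP3 q K A B c1 c2 c3 * SP q K A B c2 c3 w (D q c1 c2 c3 w N n k) := by
  obtain ⟨hq, h2, h3, nK, nA, nB, hwi⟩ := ctx w hw hw2 g n k K A B hK hA hB
  have m := @mon q g.hq N n k K A B hK hA hB
  have d0 := g.gd (2 * n) (by omega) (by omega)
  rw [m (2 * n) 2 2 0 0] at d0
  have d1 := g.gd (2 * n + 2) (by omega) (by omega)
  rw [m (2 * n + 2) 2 2 0 2] at d1
  have d2 := g.gd (n + k) (by omega) (by omega)
  rw [m (n + k) 2 1 0 0] at d2
  have d3 := g.gd (n + N + 1 + 1) (by omega) (by omega)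
  rw [m (n + N + 1 + 1) 2 2 1 2] at d3
  have d4 := g.g2 (n) (by omega) (by omega)
  rw [m (n) 1 1 0 0] at d4
  have d5 := g.gC (N + 1 + n) (by omega) (by omega)
  rw [m (N + 1 + n) 2 2 1 1] at d5
  have d7 := g.gd (2 * (n - 1) + 1) (by omega) (by omega)
  rw [RM w hw g n k (by omega) hnN hk hkN, hw2]
  unfold PhiPm RP3 SP
  rw [hK,
    hA,
    m (n - 1 + N + 2) 2 2 1 1,
    m (n - 1 + N + 3) 2 2 1 2,
    m (n - 1 + 1) 1 1 0 0,
    m (N + 1) 1 1 1 1,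
    m (2 * (n - 1) + 2) 2 2 0 0,
    m (n - k + 1) 0 1 0 1,
    m (N + 1 + n) 2 2 1 1,
    m (N - n + 1) 0 0 1 1,
    m (n + k) 2 1 0 0,
    m (n + N + 1) 2 2 1 1,
    m (n) 1 1 0 0]
  clear m
  simp only [pow_zero, pow_one, mul_one, one_mul] at *
  generalize 1 - c2 * c3 * q ^ (2 * (n - 1) + 1) = y0 at *
  generalize 1 - c2 * c3 * (K ^ 2 * A ^ 2) = y1 at *
  generalize 1 - c2 * c3 * (K ^ 2 * A ^ 2 * q ^ 2) = y2 at *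
  generalize 1 - c2 * c3 * (K ^ 2 * A) = y3 at *
  generalize 1 - c2 * c3 * (K ^ 2 * A ^ 2 * B * q ^ 2) = y4 at *
  generalize D q c1 c2 c3 w N n k = y5 at *
  generalize 1 - c2 * (K * A) = y6 at *
  generalize 1 - c1 * c2 * c3 * (K ^ 2 * A ^ 2 * B * q) = y7 at *
  generalize 1 - c1 * c2 * c3 * (K ^ 2 * A ^ 2 * B * q ^ 2) = y8 at *
  generalize 1 - c2 * c3 * (K * A) = y9 at *
  generalize 1 - c2 * c3 * (K ^ 2 * A ^ 2 * B * q) = y10 at *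
  generalize 1 - c1 * (B * q) = y11 at *
  generalize 1 - c3 * (K * A) = y12 at *
  generalize 1 - A * q = y13 at *
  generalize 1 - A = y14 at *
  simp only [div_eq_mul_inv, mul_inv, hwi]
  clear hwi
  field_simp

def LM1 (q K A B c1 c2 c3 : ℂ) : ℂ :=
  -((1-c1*c2*(K^2*A*B*q))*(1-A*q)*(1-B)*(1-c2*c3*(K^2*A^2*q))*(1-c1*c2*c3*(K^2*A*B*q))*(1-c2*c3*(K^2*A^2*B*q))*(1-c2*c3*(K^2*A)) *((1-c2*c3*(K^2*A^2))*(1-c2*c3*(K^2*A^2*q^2))))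
def LM2 (q K A B c1 c2 c3 : ℂ) : ℂ :=
  q*A*(1-B)*(1-c2*c3*(K^2*A^2*q))*(1-c1*c2*c3*(K^2*A*B*q))*(1-c1*c2*c3*(K^2*A*B))*(1-c2*c3*(K^2*A^2*B*q))*(1-c2*K)*(1-K)*((1-c2*c3*(K^2*A^2))*(1-c2*c3*(K^2*A^2*q^2)))
def RM1 (q K A B c1 c2 c3 : ℂ) : ℂ :=
  -((1-K*A*q)*(1-c2*c3*(K^2*A^2*B*q))*(1-B)*(1-c2*(K*A*q))*(1-c1*c2*c3*(K^2*A^2*B*q^2))*(1-c2*c3*(K^2*A*q))*((1-c1*c2*c3*(K^2*A^2*B*q))*(1-c2*c3*(K^2*A^2))*(1-c2*c3*(K^2*A))))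
def RM2 (q K A B c1 c2 c3 : ℂ) : ℂ :=
  q*c2*(K*(1-K*A)*(1-c3*(K*A))*(1-c2*c3*(K^2*A^2*B))*(1-c2*c3*(K^2*A^2*B*q))*(1-c2*c3*(K^2*A^2*q^2))
     + c3*K^3*A^2*(1-B)*(q-B)*(1-c2*(K*A*q))*(1-c2*c3*(K*A*q))*(1-c2*c3*(K^2*A^2))
     - (1-c2*c3*(K^2*A^2*q))*K*(1-c3*(K*A*B))*(1-K*A*B)*((1-c2*c3*(K^2*A^2))*(1-c2*c3*(K^2*A^2*q^2))))*(1-A*q)*((1-c2*c3*(K^2*A))*(1-c1*B)*(1-c1*c2*c3*(K^2*A^2*B*q)))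
def RM3 (q K A B c1 c2 c3 : ℂ) : ℂ :=
  -(c3*q*c2^2*K^4*A^2*(1-B)*(1-c2*c3*(K*A))*(1-A*q)*(1-A)*(1-c1*(B*q))*(1-c2*c3*(K^2*A^2*B*q))*(1-c3*(K*A))*((1-c2*c3*(K^2*A^2*q^2))*(1-c1*B)))

def SM (q K A B c1 c2 c3 w D : ℂ) : ℂ :=
  D * (1-B*q) * w⁻¹ * (K^2*A*B)⁻¹ * ((1-c2*c3*(K^2*A^2))*(1-c2*c3*(K^2*A^2*q^2))*(1-c2*c3*(K^2*A))*(1-c1*B)*(1-c1*c2*c3*(K^2*A^2*B*q)))⁻¹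

theorem tLM1' {q c1 c2 c3 : ℂ} (w : ℂ) (hw : w ≠ 0) (hw2 : w ^ 2 = q * c2) {N : ℤ} (g : Gen q c1 c2 c3 N)
    (n k : ℤ) (hn : 0 ≤ n) (hnN : n ≤ N) (hk : 0 ≤ k) (hkN : k ≤ N)
    (K A B : ℂ) (hK : q ^ k = K) (hA : q ^ (n - k) = A) (hB : q ^ (N - n) = B) :
    k < N → lamM q c1 c2 c3 N k * H q c1 c2 c3 w (N - 1) n k
      = LM1 q K A B c1 c2 c3 * SM q K A B c1 c2 c3 w (D q c1 c2 c3 w N n k) := by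
  obtain ⟨hq, h2, h3, nK, nA, nB, hwi⟩ := ctx w hw hw2 g n k K A B hK hA hB
  have m := @mon q g.hq N n k K A B hK hA hB
  have d0 := g.gd (2 * n) (by omega) (by omega)
  rw [m (2 * n) 2 2 0 0] at d0
  have d1 := g.gd (2 * n + 2) (by omega) (by omega)
  rw [m (2 * n + 2) 2 2 0 2] at d1
  have d2 := g.gd (n + k) (by omega) (by omega)
  rw [m (n + k) 2 1 0 0] at d2
  have d3 := g.g1 (N - n) (by omega) (by omega)
  rw [m (N - n) 0 0 1 0] at d3
  have d4 := g.gC (N + 1 + n) (by omega) (by omega)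
  rw [m (N + 1 + n) 2 2 1 1] at d4
  intro hk'
  have z : lamM q c1 c2 c3 N k = -((1 - c1 * c2 * q ^ (N + k + 1)) * (K * A * B)⁻¹) * (1 - q ^ (N - k)) := by
    unfold lamM
    rw [zpow_neg, zpow_neg, hK, m N 1 1 1 0, m (N - k) 0 1 1 0]
    simp only [pow_zero, pow_one, mul_one, one_mul]
    have : (K * A * B)⁻¹ - K⁻¹ = (1 - A * B) * (K * A * B)⁻¹ := by field_simp
    rw [this]; ring
  rw [z, mul_assoc, RL w hw g n k hn hnN hk hk']
  unfold LM1 SM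
  rw [hK,
    hB,
    m (N + k + 1) 2 1 1 1,
    m (n - k + 1) 0 1 0 1,
    m (N - n + 1) 0 0 1 1,
    m (2 * n + 1) 2 2 0 1,
    m (N + 1 + n) 2 2 1 1,
    m (N + 1 + k) 2 1 1 1,
    m (n + N + 1) 2 2 1 1]
  clear m
  simp only [pow_zero, pow_one, mul_one, one_mul] at *
  generalize 1 - c2 * c3 * (K ^ 2 * A ^ 2) = y0 at *
  generalize 1 - c2 * c3 * (K ^ 2 * A ^ 2 * q ^ 2) = y1 at *
  generalize 1 - c2 * c3 * (K ^ 2 * A) = y2 at *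
  generalize 1 - c1 * B = y3 at *
  generalize 1 - c1 * c2 * c3 * (K ^ 2 * A ^ 2 * B * q) = y4 at *
  generalize 1 - c2 * c3 * (K ^ 2 * A ^ 2 * q) = y5 at *
  generalize D q c1 c2 c3 w N n k = y6 at *
  generalize 1 - B * q = y7 at *
  generalize 1 - c1 * c2 * (K ^ 2 * A * B * q) = y8 at *
  generalize 1 - c1 * c2 * c3 * (K ^ 2 * A * B * q) = y9 at *
  generalize 1 - c2 * c3 * (K ^ 2 * A ^ 2 * B * q) = y10 at *
  generalize 1 - A * q = y11 at *
  generalize 1 - B = y12 at *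
  simp only [div_eq_mul_inv, mul_inv, hwi]
  clear hwi
  field_simp


theorem tLM2 {q c1 c2 c3 : ℂ} (w : ℂ) (hw : w ≠ 0) (hw2 : w ^ 2 = q * c2) {N : ℤ} (g : Gen q c1 c2 c3 N)
    (n k : ℤ) (hn : 0 ≤ n) (hnN : n ≤ N) (hk : 0 ≤ k) (hkN : k ≤ N)
    (K A B : ℂ) (hK : q ^ k = K) (hA : q ^ (n - k) = A) (hB : q ^ (N - n) = B) :
    q / q ^ k * H q c1 c2 c3 w (N - 1) n (k - 1)
      = LM2 q K A B c1 c2 c3 * SM q K A B c1 c2 c3 w (D q c1 c2 c3 w N n k) := by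
  obtain ⟨hq, h2, h3, nK, nA, nB, hwi⟩ := ctx w hw hw2 g n k K A B hK hA hB
  have m := @mon q g.hq N n k K A B hK hA hB
  have d0 := g.gd (2 * n) (by omega) (by omega)
  rw [m (2 * n) 2 2 0 0] at d0
  have d1 := g.gd (2 * n + 2) (by omega) (by omega)
  rw [m (2 * n + 2) 2 2 0 2] at d1
  have d2 := g.gd (n + k) (by omega) (by omega)
  rw [m (n + k) 2 1 0 0] at d2
  have d3 := g.g1 (N - n) (by omega) (by omega)
  rw [m (N - n) 0 0 1 0] at d3
  have d4 := g.gC (N + 1 + n) (by omega) (by omega)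
  rw [m (N + 1 + n) 2 2 1 1] at d4
  rw [RLk w hw g n k hn hnN hk hkN]
  unfold LM2 SM
  rw [hK,
    hB,
    m (N - n + 1) 0 0 1 1,
    m (2 * n + 1) 2 2 0 1,
    m (N + 1 + n) 2 2 1 1,
    m (n + k) 2 1 0 0,
    m (N + 1 + k) 2 1 1 1,
    m (N + k) 2 1 1 0,
    m (n + N + 1) 2 2 1 1]
  clear m
  simp only [pow_zero, pow_one, mul_one, one_mul] at *
  generalize 1 - c2 * c3 * (K ^ 2 * A ^ 2) = y0 at *
  generalize 1 - c2 * c3 * (K ^ 2 * A ^ 2 * q ^ 2) = y1 at *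
  generalize 1 - c2 * c3 * (K ^ 2 * A) = y2 at *
  generalize 1 - c1 * B = y3 at *
  generalize 1 - c1 * c2 * c3 * (K ^ 2 * A ^ 2 * B * q) = y4 at *
  generalize 1 - c2 * c3 * (K ^ 2 * A ^ 2 * q) = y5 at *
  generalize D q c1 c2 c3 w N n k = y6 at *
  generalize 1 - B * q = y7 at *
  generalize 1 - c1 * c2 * c3 * (K ^ 2 * A * B * q) = y8 at *
  generalize 1 - c1 * c2 * c3 * (K ^ 2 * A * B) = y9 at *
  generalize 1 - c2 * c3 * (K ^ 2 * A ^ 2 * B * q) = y10 at *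
  generalize 1 - c2 * K = y11 at *
  generalize 1 - K = y12 at *
  generalize 1 - B = y13 at *
  simp only [div_eq_mul_inv, mul_inv, hwi]
  clear hwi
  field_simp


theorem tRM1 {q c1 c2 c3 : ℂ} (w : ℂ) (hw : w ≠ 0) (hw2 : w ^ 2 = q * c2) {N : ℤ} (g : Gen q c1 c2 c3 N)
    (n k : ℤ) (hn : 0 ≤ n) (hnN : n ≤ N) (hk : 0 ≤ k) (hkN : k ≤ N)
    (K A B : ℂ) (hK : q ^ k = K) (hA : q ^ (n - k) = A) (hB : q ^ (N - n) = B) :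
    PhiMp q w c1 c2 c3 N (n + 1) * H q c1 c2 c3 w N (n + 1) k
      = RM1 q K A B c1 c2 c3 * SM q K A B c1 c2 c3 w (D q c1 c2 c3 w N n k) := by
  obtain ⟨hq, h2, h3, nK, nA, nB, hwi⟩ := ctx w hw hw2 g n k K A B hK hA hB
  have m := @mon q g.hq N n k K A B hK hA hB
  have d0 := g.gd (2 * n) (by omega) (by omega)
  rw [m (2 * n) 2 2 0 0] at d0
  have d1 := g.gd (2 * n + 2) (by omega) (by omega)
  rw [m (2 * n + 2) 2 2 0 2] at d1
  have d2 := g.gd (n + k) (by omega) (by omega)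
  rw [m (n + k) 2 1 0 0] at d2
  have d3 := g.g1 (N - n) (by omega) (by omega)
  rw [m (N - n) 0 0 1 0] at d3
  have d4 := g.gC (N + 1 + n) (by omega) (by omega)
  rw [m (N + 1 + n) 2 2 1 1] at d4
  have d5 := g.gd (n + N + 1 + 1) (by omega) (by omega)
  rw [m (n + N + 1 + 1) 2 2 1 2] at d5
  have d6 := g.gd (2 * n + 3) (by omega) (by omega)
  rw [m (2 * n + 3) 2 2 0 3] at d6
  have d7 := g.g3 (n + 1) (by omega) (by omega)
  rw [m (n + 1) 1 1 0 1] at d7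
  rw [RP w hw g n k hn hnN hk hkN, hw2]
  unfold PhiMp RM1 SM
  rw [hK,
    m (2 * (n + 1) + 1) 2 2 0 3,
    m (2 * (n + 1)) 2 2 0 2,
    hB,
    m (N - n + 1) 0 0 1 1,
    m (n + 1 + N + 1) 2 2 1 2,
    m (n + 1 + N) 2 2 1 1,
    m (n + 1) 1 1 0 1,
    m (N + 1 + n + 1) 2 2 1 2,
    m (n + k + 1) 2 1 0 1,
    m (n + N + 1 + 1) 2 2 1 2,
    m (N) 1 1 1 0]
  clear m
  simp only [pow_zero, pow_one, mul_one, one_mul] at *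
  generalize 1 - c2 * c3 * (K ^ 2 * A ^ 2) = y0 at *
  generalize 1 - c2 * c3 * (K ^ 2 * A ^ 2 * q ^ 2) = y1 at *
  generalize 1 - c2 * c3 * (K ^ 2 * A) = y2 at *
  generalize 1 - c1 * B = y3 at *
  generalize 1 - c1 * c2 * c3 * (K ^ 2 * A ^ 2 * B * q) = y4 at *
  generalize 1 - c2 * c3 * (K ^ 2 * A ^ 2 * q) = y5 at *
  generalize D q c1 c2 c3 w N n k = y6 at *
  generalize 1 - B * q = y7 at *
  generalize 1 - c2 * c3 * (K ^ 2 * A ^ 2 * B * q ^ 2) = y8 at *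
  generalize 1 - c2 * c3 * (K ^ 2 * A ^ 2 * q ^ 3) = y9 at *
  generalize 1 - c3 * (K * A * q) = y10 at *
  generalize 1 - K * A * q = y11 at *
  generalize 1 - B = y12 at *
  generalize 1 - c2 * (K * A * q) = y13 at *
  generalize 1 - c1 * c2 * c3 * (K ^ 2 * A ^ 2 * B * q ^ 2) = y14 at *
  generalize 1 - c2 * c3 * (K ^ 2 * A * q) = y15 at *
  generalize 1 - c2 * c3 * (K ^ 2 * A ^ 2 * B * q) = y16 at *
  simp only [div_eq_mul_inv, mul_inv, hwi]
  clear hwi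
  field_simp


theorem tRM2 {q c1 c2 c3 : ℂ} (w : ℂ) (hw : w ≠ 0) (hw2 : w ^ 2 = q * c2) {N : ℤ} (g : Gen q c1 c2 c3 N)
    (n k : ℤ) (hn : 0 ≤ n) (hnN : n ≤ N) (hk : 0 ≤ k) (hkN : k ≤ N)
    (K A B : ℂ) (hK : q ^ k = K) (hA : q ^ (n - k) = A) (hB : q ^ (N - n) = B) :
    PhiM0 q w c1 c2 c3 N n * H q c1 c2 c3 w N n k
      = RM2 q K A B c1 c2 c3 * SM q K A B c1 c2 c3 w (D q c1 c2 c3 w N n k) := by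
  obtain ⟨hq, h2, h3, nK, nA, nB, hwi⟩ := ctx w hw hw2 g n k K A B hK hA hB
  have m := @mon q g.hq N n k K A B hK hA hB
  have d0 := g.gd (2 * n) (by omega) (by omega)
  rw [m (2 * n) 2 2 0 0] at d0
  have d1 := g.gd (2 * n + 2) (by omega) (by omega)
  rw [m (2 * n + 2) 2 2 0 2] at d1
  have d2 := g.gd (n + k) (by omega) (by omega)
  rw [m (n + k) 2 1 0 0] at d2
  have d3 := g.g1 (N - n) (by omega) (by omega)
  rw [m (N - n) 0 0 1 0] at d3
  have d4 := g.gC (N + 1 + n) (by omega) (by omega)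
  rw [m (N + 1 + n) 2 2 1 1] at d4
  have d5 := g.gd (2 * n + 1) (by omega) (by omega)
  rw [m (2 * n + 1) 2 2 0 1] at d5
  have z1 : q ^ (n - N) = B⁻¹ := by rw [← hB, ← zpow_neg]; congr 1; ring
  have z2 : q ^ (n - N + 1) = q * B⁻¹ := by rw [zpow_add₀ hq, z1, zpow_one, mul_comm]
  have zz1 : 1 - B⁻¹ = -(1 - B) * B⁻¹ := by field_simp; ring
  have zz2 : 1 - q * B⁻¹ = -(q - B) * B⁻¹ := by field_simp; ring
  have zz3 : (K * A * B)⁻¹ - 1 = (1 - K * A * B) * (K * A * B)⁻¹ := by field_simp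
  rw [R0 w g n k hn hnN hk]
  unfold PhiM0 PhiMp PhiMm RM2 SM
  rw [z1,
    z2,
    zz1,
    zz2,
    zpow_neg,
    m (2 * n + 1) 2 2 0 1,
    m (2 * n + 2) 2 2 0 2,
    m (2 * n) 2 2 0 0,
    m (N - n + 1) 0 0 1 1,
    m (n + N + 1) 2 2 1 1,
    m (n + N) 2 2 1 0,
    m (n + 1) 1 1 0 1,
    m (n - k + 1) 0 1 0 1,
    m (n) 1 1 0 0,
    m (N) 1 1 1 0]
  clear m
  simp only [pow_zero, pow_one, mul_one, one_mul] at *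
  generalize 1 - c2 * c3 * (K ^ 2 * A ^ 2) = y0 at *
  generalize 1 - c2 * c3 * (K ^ 2 * A ^ 2 * q ^ 2) = y1 at *
  generalize 1 - c2 * c3 * (K ^ 2 * A) = y2 at *
  generalize 1 - c1 * B = y3 at *
  generalize 1 - c1 * c2 * c3 * (K ^ 2 * A ^ 2 * B * q) = y4 at *
  generalize 1 - c2 * c3 * (K ^ 2 * A ^ 2 * q) = y5 at *
  generalize D q c1 c2 c3 w N n k = y6 at *
  generalize 1 - B * q = y7 at *
  generalize 1 - K * A * B = y8 at *
  generalize 1 - c3 * (K * A) = y9 at *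
  generalize 1 - K * A = y10 at *
  generalize 1 - c2 * c3 * (K ^ 2 * A ^ 2 * B) = y11 at *
  generalize 1 - c2 * c3 * (K ^ 2 * A ^ 2 * B * q) = y12 at *
  generalize 1 - B = y13 at *
  generalize q - B = y14 at *
  generalize 1 - c2 * (K * A * q) = y15 at *
  generalize 1 - c2 * c3 * (K * A * q) = y16 at *
  generalize 1 - c3 * (K * A * B) = y17 at *
  generalize 1 - A * q = y18 at *
  clear zz1 zz2
  simp only [div_eq_mul_inv, mul_inv, hwi] at zz3 ⊢
  rw [zz3]
  clear hwi zz3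
  field_simp
  ring


theorem tRM3' {q c1 c2 c3 : ℂ} (w : ℂ) (hw : w ≠ 0) (hw2 : w ^ 2 = q * c2) {N : ℤ} (g : Gen q c1 c2 c3 N)
    (n k : ℤ) (hn : 1 ≤ n) (hnN : n ≤ N) (hk : 0 ≤ k) (hkN : k ≤ N)
    (K A B : ℂ) (hK : q ^ k = K) (hA : q ^ (n - k) = A) (hB : q ^ (N - n) = B) :
    PhiMm q w c1 c2 c3 N (n - 1) * H q c1 c2 c3 w N (n - 1) k
      = RM3 q K A B c1 c2 c3 * SM q K A B c1 c2 c3 w (D q c1 c2 c3 w N n k) := by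
  obtain ⟨hq, h2, h3, nK, nA, nB, hwi⟩ := ctx w hw hw2 g n k K A B hK hA hB
  have m := @mon q g.hq N n k K A B hK hA hB
  have d0 := g.gd (2 * n) (by omega) (by omega)
  rw [m (2 * n) 2 2 0 0] at d0
  have d1 := g.gd (2 * n + 2) (by omega) (by omega)
  rw [m (2 * n + 2) 2 2 0 2] at d1
  have d2 := g.gd (n + k) (by omega) (by omega)
  rw [m (n + k) 2 1 0 0] at d2
  have d3 := g.g1 (N - n) (by omega) (by omega)
  rw [m (N - n) 0 0 1 0] at d3
  have d4 := g.gC (N + 1 + n) (by omega) (by omega)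
  rw [m (N + 1 + n) 2 2 1 1] at d4
  have d5 := g.g2 (n) (by omega) (by omega)
  rw [m (n) 1 1 0 0] at d5
  have z1 : q ^ (n - 1 - N) = (B * q)⁻¹ := by
    rw [← hB, ← zpow_add_one₀ hq, ← zpow_neg]; congr 1; ring
  have z2 : q ^ (n - 1 - N + 1) = B⁻¹ := by rw [← hB, ← zpow_neg]; congr 1; ring
  have zz1 : 1 - (B * q)⁻¹ = -(1 - B * q) * (B * q)⁻¹ := by field_simp; ring
  have zz2 : 1 - B⁻¹ = -(1 - B) * B⁻¹ := by field_simp; ring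
  have d7 := g.gd (2 * (n - 1) + 1) (by omega) (by omega)
  rw [RM w hw g n k (by omega) hnN hk hkN, hw2]
  unfold PhiMm RM3 SM
  rw [hK,
    hA,
    z2,
    z1,
    zz1,
    zz2,
    m (n - 1 + 1) 1 1 0 0,
    m (2 * (n - 1) + 2) 2 2 0 0,
    m (n - k + 1) 0 1 0 1,
    m (N + 1 + n) 2 2 1 1,
    m (N - n + 1) 0 0 1 1,
    m (n + k) 2 1 0 0,
    m (n + N + 1) 2 2 1 1,
    m (n) 1 1 0 0,
    m (N) 1 1 1 0]
  clear m
  simp only [pow_zero, pow_one, mul_one, one_mul] at *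
  generalize 1 - c2 * c3 * q ^ (2 * (n - 1) + 1) = y0 at *
  generalize 1 - c2 * c3 * (K ^ 2 * A ^ 2) = y1 at *
  generalize 1 - c2 * c3 * (K ^ 2 * A ^ 2 * q ^ 2) = y2 at *
  generalize 1 - c2 * c3 * (K ^ 2 * A) = y3 at *
  generalize 1 - c1 * B = y4 at *
  generalize 1 - c1 * c2 * c3 * (K ^ 2 * A ^ 2 * B * q) = y5 at *
  generalize 1 - c2 * c3 * (K ^ 2 * A ^ 2 * q) = y6 at *
  generalize D q c1 c2 c3 w N n k = y7 at *
  generalize 1 - B * q = y8 at *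
  generalize 1 - c2 * (K * A) = y9 at *
  generalize 1 - c2 * c3 * (K * A) = y10 at *
  generalize 1 - c2 * c3 * (K ^ 2 * A ^ 2 * B * q) = y11 at *
  generalize 1 - c1 * (B * q) = y12 at *
  generalize 1 - c3 * (K * A) = y13 at *
  generalize 1 - A * q = y14 at *
  generalize 1 - A = y15 at *
  generalize 1 - B = y16 at *
  clear z1 z2 zz1 zz2
  simp only [div_eq_mul_inv, mul_inv, hwi]
  clear hwi
  field_simp


theorem tRP3 {q c1 c2 c3 : ℂ} (w : ℂ) (hw : w ≠ 0) (hw2 : w ^ 2 = q * c2) {N : ℤ} (g : Gen q c1 c2 c3 N)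
    (n k : ℤ) (hn : 0 ≤ n) (hnN : n ≤ N) (hk : 0 ≤ k) (hkN : k ≤ N) (hkn : k ≤ n + 1)
    (K A B : ℂ) (hK : q ^ k = K) (hA : q ^ (n - k) = A) (hB : q ^ (N - n) = B) :
    PhiPm q w c1 c2 c3 N (n - 1) * H q c1 c2 c3 w N (n - 1) k
      = RP3 q K A B c1 c2 c3 * SP q K A B c2 c3 w (D q c1 c2 c3 w N n k) := by
  by_cases h : 1 ≤ n
  · exact tRP3' w hw hw2 g n k h hnN hk hkN K A B hK hA hB
  · obtain rfl : n = 0 := by omega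
    rw [H_zero _ _ _ _ _ _ _ _ (Or.inl (by omega)), mul_zero]
    have : (1 - A * q) * (1 - A) = 0 := by
      rcases (by omega : k = 0 ∨ k = 1) with rfl | rfl
      · rw [← hA]; simp
      · rw [← hA]; simp [g.hq]
    have : RP3 q K A B c1 c2 c3 = 0 := by
      unfold RP3
      rcases mul_eq_zero.1 this with h | h <;> rw [h] <;> ring
    rw [this, zero_mul]

theorem tRM3 {q c1 c2 c3 : ℂ} (w : ℂ) (hw : w ≠ 0) (hw2 : w ^ 2 = q * c2) {N : ℤ} (g : Gen q c1 c2 c3 N)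
    (n k : ℤ) (hn : 0 ≤ n) (hnN : n ≤ N) (hk : 0 ≤ k) (hkN : k ≤ N) (hkn : k ≤ n + 1)
    (K A B : ℂ) (hK : q ^ k = K) (hA : q ^ (n - k) = A) (hB : q ^ (N - n) = B) :
    PhiMm q w c1 c2 c3 N (n - 1) * H q c1 c2 c3 w N (n - 1) k
      = RM3 q K A B c1 c2 c3 * SM q K A B c1 c2 c3 w (D q c1 c2 c3 w N n k) := by
  by_cases h : 1 ≤ n
  · exact tRM3' w hw hw2 g n k h hnN hk hkN K A B hK hA hB
  · obtain rfl : n = 0 := by omega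
    rw [H_zero _ _ _ _ _ _ _ _ (Or.inl (by omega)), mul_zero]
    have : (1 - A * q) * (1 - A) = 0 := by
      rcases (by omega : k = 0 ∨ k = 1) with rfl | rfl
      · rw [← hA]; simp
      · rw [← hA]; simp [g.hq]
    have : RM3 q K A B c1 c2 c3 = 0 := by
      unfold RM3
      rcases mul_eq_zero.1 this with h | h <;> rw [h] <;> ring
    rw [this, zero_mul]

theorem tLM1 {q c1 c2 c3 : ℂ} (w : ℂ) (hw : w ≠ 0) (hw2 : w ^ 2 = q * c2) {N : ℤ} (g : Gen q c1 c2 c3 N)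
    (n k : ℤ) (hn : 0 ≤ n) (hnN : n ≤ N) (hk : 0 ≤ k) (hkN : k ≤ N) (hkn : k ≤ n + 1)
    (K A B : ℂ) (hK : q ^ k = K) (hA : q ^ (n - k) = A) (hB : q ^ (N - n) = B) :
    lamM q c1 c2 c3 N k * H q c1 c2 c3 w (N - 1) n k
      = LM1 q K A B c1 c2 c3 * SM q K A B c1 c2 c3 w (D q c1 c2 c3 w N n k) := by
  by_cases h : k < N
  · exact tLM1' w hw hw2 g n k hn hnN hk hkN K A B hK hA hB h
  · obtain rfl : k = N := by omega
    have h0 : lamM q c1 c2 c3 k k = 0 := by unfold lamM; simp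
    rw [h0, zero_mul]
    have : (1 - A * q) * (1 - B) = 0 := by
      rcases (by omega : n = k ∨ n = k - 1) with rfl | rfl
      · rw [← hB]; simp
      · rw [← hA]; simp [g.hq]
    have : LM1 q K A B c1 c2 c3 = 0 := by
      unfold LM1
      rcases mul_eq_zero.1 this with h | h <;> rw [h] <;> ring
    rw [this, zero_mul]

set_option maxHeartbeats 4000000 in
set_option maxRecDepth 100000 in
theorem polyP (q K A B c1 c2 c3 : ℂ) : LP1 q K A B c1 c2 c3 - LP2 q K A B c1 c2 c3
    = RP1 q K A B c1 c2 c3 + RP2 q K A B c1 c2 c3 + RP3 q K A B c1 c2 c3 := by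
  unfold LP1 LP2 RP1 RP2 RP3
  ring

set_option maxHeartbeats 4000000 in
set_option maxRecDepth 100000 in
theorem polyM (q K A B c1 c2 c3 : ℂ) : LM1 q K A B c1 c2 c3 - LM2 q K A B c1 c2 c3
    = RM1 q K A B c1 c2 c3 + RM2 q K A B c1 c2 c3 + RM3 q K A B c1 c2 c3 := by
  unfold LM1 LM2 RM1 RM2 RM3
  ring

theorem comb (a b c d e S : ℂ) (h : a - b = c + d + e) : a * S - b * S = c * S + d * S + e * S := by
  rw [← sub_mul, h, add_mul, add_mul]

theorem termP {q c1 c2 c3 : ℂ} (w : ℂ) (hw : w ≠ 0) (hw2 : w ^ 2 = q * c2) {N : ℤ} (g : Gen q c1 c2 c3 N)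
    (n k : ℤ) (hn : 0 ≤ n) (hnN : n ≤ N) (hk : 0 ≤ k) (hkN : k ≤ N) (hkn : k ≤ n + 1) :
    lamP q c1 c2 c3 N k * H q c1 c2 c3 w (N + 1) n k - q / q ^ k * H q c1 c2 c3 w (N + 1) n (k - 1)
      = PhiPp q w c1 c2 c3 N (n + 1) * H q c1 c2 c3 w N (n + 1) k
        + PhiP0 q w c1 c2 c3 N n * H q c1 c2 c3 w N n k
        + PhiPm q w c1 c2 c3 N (n - 1) * H q c1 c2 c3 w N (n - 1) k := by
  rw [tLP1 w hw g n k hn hnN hk hkN _ _ _ rfl rfl rfl,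
    tLP2 w hw hw2 g n k hn hnN hk hkN _ _ _ rfl rfl rfl,
    tRP1 w hw hw2 g n k hn hnN hk hkN _ _ _ rfl rfl rfl,
    tRP2 w hw hw2 g n k hn hnN hk hkN _ _ _ rfl rfl rfl,
    tRP3 w hw hw2 g n k hn hnN hk hkN hkn _ _ _ rfl rfl rfl]
  exact comb _ _ _ _ _ _ (polyP _ _ _ _ _ _ _)

theorem termM {q c1 c2 c3 : ℂ} (w : ℂ) (hw : w ≠ 0) (hw2 : w ^ 2 = q * c2) {N : ℤ} (g : Gen q c1 c2 c3 N)
    (n k : ℤ) (hn : 0 ≤ n) (hnN : n ≤ N) (hk : 0 ≤ k) (hkN : k ≤ N) (hkn : k ≤ n + 1) :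
    lamM q c1 c2 c3 N k * H q c1 c2 c3 w (N - 1) n k - q / q ^ k * H q c1 c2 c3 w (N - 1) n (k - 1)
      = PhiMp q w c1 c2 c3 N (n + 1) * H q c1 c2 c3 w N (n + 1) k
        + PhiM0 q w c1 c2 c3 N n * H q c1 c2 c3 w N n k
        + PhiMm q w c1 c2 c3 N (n - 1) * H q c1 c2 c3 w N (n - 1) k := by
  rw [tLM1 w hw hw2 g n k hn hnN hk hkN hkn _ _ _ rfl rfl rfl,
    tLM2 w hw hw2 g n k hn hnN hk hkN _ _ _ rfl rfl rfl,
    tRM1 w hw hw2 g n k hn hnN hk hkN _ _ _ rfl rfl rfl,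
    tRM2 w hw hw2 g n k hn hnN hk hkN _ _ _ rfl rfl rfl,
    tRM3 w hw hw2 g n k hn hnN hk hkN hkn _ _ _ rfl rfl rfl]
  exact comb _ _ _ _ _ _ (polyM _ _ _ _ _ _ _)

theorem lamP_id (q c1 c2 c3 : ℂ) (hq : q ≠ 0) (h3 : c3 ≠ 0) (N x : ℤ) (k : ℕ) :
    lamP q c1 c2 c3 N x = lamP q c1 c2 c3 N k
      - (q ^ k)⁻¹ * ((1 - q ^ (-x) * q ^ k) * (1 - c1 * c2 * q ^ (x + 1) * q ^ k)) := by
  unfold lamP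
  have hN : q ^ N ≠ 0 := zpow_ne_zero _ hq
  have hX : q ^ x ≠ 0 := zpow_ne_zero _ hq
  have hk : q ^ k ≠ 0 := pow_ne_zero _ hq
  rw [show -N - 1 = -(N + 1) by ring, show N + x + 2 = N + x + 1 + 1 by ring,
    show N + k + 2 = N + k + 1 + 1 by ring]
  simp only [zpow_neg, zpow_add₀ hq, zpow_one, zpow_natCast]
  generalize q ^ N = a at *
  generalize q ^ x = b at *
  generalize q ^ k = c at *
  field_simp
  ring

theorem lamM_id (q c1 c2 c3 : ℂ) (hq : q ≠ 0) (N x : ℤ) (k : ℕ) :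
    lamM q c1 c2 c3 N x = lamM q c1 c2 c3 N k
      - (q ^ k)⁻¹ * ((1 - q ^ (-x) * q ^ k) * (1 - c1 * c2 * q ^ (x + 1) * q ^ k)) := by
  unfold lamM
  have hN : q ^ N ≠ 0 := zpow_ne_zero _ hq
  have hX : q ^ x ≠ 0 := zpow_ne_zero _ hq
  have hk : q ^ k ≠ 0 := pow_ne_zero _ hq
  simp only [zpow_neg, zpow_add₀ hq, zpow_one, zpow_natCast]
  generalize q ^ N = a at *
  generalize q ^ x = b at *
  generalize q ^ k = c at *
  field_simp
  ring

theorem H_negk (q c1 c2 c3 w : ℂ) (N n : ℤ) : H q c1 c2 c3 w N n (-1) = 0 := by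
  unfold H; rw [F_one_neg q (-1) (by norm_num)]; simp

theorem sum3 (f a b c : ℕ → ℂ) (u v z : ℂ) (m : ℕ) :
    ∑ k ∈ Finset.range m, (u * a k + v * b k + z * c k) * f k
      = z * (∑ k ∈ Finset.range m, c k * f k) + (v * (∑ k ∈ Finset.range m, b k * f k)
        + u * (∑ k ∈ Finset.range m, a k * f k)) := by
  simp only [Finset.mul_sum, ← Finset.sum_add_distrib]
  apply Finset.sum_congr rfl; intro k _; ring

theorem main (N : ℕ) (q s c1 c2 c3 t2 : ℂ) (hw : s * t2 ≠ 0) (hw2 : (s * t2) ^ 2 = q * c2)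
    (g : Gen q c1 c2 c3 N) (hq1 : ∀ k : ℕ, 1 ≤ k → k ≤ N + 1 → q ^ k ≠ 1)
    (n : ℕ) (x : ℤ) (hnN : n ≤ N) (hx0 : 0 ≤ x) (hxN : x ≤ (N : ℤ)) :
    (lamP q c1 c2 c3 (N : ℤ) x * p q s c1 c2 c3 t2 ((N : ℤ) + 1) n x
        = PhiPm q (s * t2) c1 c2 c3 N (n - 1) * p q s c1 c2 c3 t2 N (n - 1) x
        + (PhiP0 q (s * t2) c1 c2 c3 N n * p q s c1 c2 c3 t2 N n x
        + PhiPp q (s * t2) c1 c2 c3 N (n + 1) * p q s c1 c2 c3 t2 N (n + 1) x)) ∧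
    (lamM q c1 c2 c3 (N : ℤ) x * p q s c1 c2 c3 t2 ((N : ℤ) - 1) n x
        = PhiMm q (s * t2) c1 c2 c3 N (n - 1) * p q s c1 c2 c3 t2 N (n - 1) x
        + (PhiM0 q (s * t2) c1 c2 c3 N n * p q s c1 c2 c3 t2 N n x
        + PhiMp q (s * t2) c1 c2 c3 N (n + 1) * p q s c1 c2 c3 t2 N (n + 1) x)) := by
  have hq := g.hq
  have P : ∀ (M m : ℤ), M ≤ N + 1 → x ≤ M → m < n + 2 → p q s c1 c2 c3 t2 M m x
      = ∑ k ∈ Finset.range (n + 2), H q c1 c2 c3 (s * t2) M m k * Bk q c1 c2 x k := by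
    intro M m h1 h2 h3
    exact p_eq q s c1 c2 c3 t2 hq hw M m x (n + 2) hx0 h2 (by push_cast; exact h3)
      (fun j a b => hq1 j a (by omega)) (fun j a b => g.gC j (by omega) (by omega))
      (fun j a b => g.gd j (by omega) (by omega))
  rw [P N (n - 1) (by omega) hxN (by omega), P N n (by omega) hxN (by omega),
    P N (n + 1) (by omega) hxN (by omega), P (N + 1) n (by omega) (by omega) (by omega)]
  constructor
  · rw [← sum3]
    exact sum_frame q c1 c2 _ hq n x (fun k => lamP q c1 c2 c3 N k)
      (fun k => H q c1 c2 c3 (s * t2) (N + 1) n k)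
      (fun k => PhiPp q (s * t2) c1 c2 c3 N (n + 1) * H q c1 c2 c3 (s * t2) N (n + 1) k
        + PhiP0 q (s * t2) c1 c2 c3 N n * H q c1 c2 c3 (s * t2) N n k
        + PhiPm q (s * t2) c1 c2 c3 N (n - 1) * H q c1 c2 c3 (s * t2) N (n - 1) k) hx0 N hxN
      (fun k => lamP_id q c1 c2 c3 hq g.h3 N x k) (H_negk _ _ _ _ _ _ _)
      (H_zero _ _ _ _ _ _ _ _ (Or.inl (by omega)))
      (fun k h1 h2 => by
        have := termP (s * t2) hw hw2 g n k (by omega) (by omega) (by omega) (by omega) (by omega)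
        rw [zpow_natCast] at this
        exact this)
  · have hL : lamM q c1 c2 c3 (N : ℤ) x * p q s c1 c2 c3 t2 ((N : ℤ) - 1) n x
        = lamM q c1 c2 c3 (N : ℤ) x * ∑ k ∈ Finset.range (n + 2),
          H q c1 c2 c3 (s * t2) (N - 1) n k * Bk q c1 c2 x k := by
      by_cases h : x ≤ (N : ℤ) - 1
      · rw [P (N - 1) n (by omega) h (by omega)]
      · obtain rfl : x = N := by omega
        have h0 : lamM q c1 c2 c3 (N : ℤ) N = 0 := by unfold lamM; simp
        rw [h0, zero_mul, zero_mul]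
    rw [hL, ← sum3]
    exact sum_frame q c1 c2 _ hq n x (fun k => lamM q c1 c2 c3 N k)
      (fun k => H q c1 c2 c3 (s * t2) (N - 1) n k)
      (fun k => PhiMp q (s * t2) c1 c2 c3 N (n + 1) * H q c1 c2 c3 (s * t2) N (n + 1) k
        + PhiM0 q (s * t2) c1 c2 c3 N n * H q c1 c2 c3 (s * t2) N n k
        + PhiMm q (s * t2) c1 c2 c3 N (n - 1) * H q c1 c2 c3 (s * t2) N (n - 1) k) hx0 N hxN
      (fun k => lamM_id q c1 c2 c3 hq N x k) (H_negk _ _ _ _ _ _ _)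
      (H_zero _ _ _ _ _ _ _ _ (Or.inl (by omega)))
      (fun k h1 h2 => by
        have := termM (s * t2) hw hw2 g n k (by omega) (by omega) (by omega) (by omega) (by omega)
        rw [zpow_natCast] at this
        exact this)

theorem gen_aux (q a : ℂ) (hq : q ≠ 0) (m : ℤ) (h : a ≠ q ^ (-m)) : 1 - a * q ^ m ≠ 0 := by
  intro h0
  apply h
  rw [zpow_neg]
  exact eq_inv_of_mul_eq_one_left (by linear_combination -h0)

end qRx

/-- Contiguity recurrence relations for the normalized q-Racah polynomials
(the first conjunct is the plus sign, the second the minus sign). -/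
theorem qRacah_contiguity_recurrence
    (N : ℕ) (q s c1 c2 c3 t1 t2 t3 : ℂ)
    (hq : q ≠ 0) (hc1 : c1 ≠ 0) (hc2 : c2 ≠ 0) (hc3 : c3 ≠ 0)
    (hs : s ^ 2 = q) (ht1 : t1 ^ 2 = c1) (ht2 : t2 ^ 2 = c2) (ht3 : t3 ^ 2 = c3)
    (hgen : ∀ e1 e2 e3 : ℕ, e1 ≤ 1 → e2 ≤ 1 → e3 ≤ 1 → 1 ≤ e1 + e2 + e3 →
      ∀ k : ℤ, 0 ≤ k → k ≤ 2 * (N : ℤ) + 5 → c1 ^ e1 * c2 ^ e2 * c3 ^ e3 ≠ q ^ (-k))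
    (hq1 : ∀ k : ℕ, 1 ≤ k → k ≤ N + 1 → q ^ k ≠ 1)
    (n x : ℤ) (hn0 : 0 ≤ n) (hnN : n ≤ (N : ℤ)) (hx0 : 0 ≤ x) (hxN : x ≤ (N : ℤ)) :
    (qR.lamP q c1 c2 c3 (N : ℤ) x * qR.p q s c1 c2 c3 t2 ((N : ℤ) + 1) n x
        = ∑ ε ∈ ({-1, 0, 1} : Finset ℤ),
            qR.PhiC q (s * t2) c1 c2 c3 1 ε (N : ℤ) (n + ε)
              * qR.p q s c1 c2 c3 t2 (N : ℤ) (n + ε) x)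
    ∧
    (qR.lamM q c1 c2 c3 (N : ℤ) x * qR.p q s c1 c2 c3 t2 ((N : ℤ) - 1) n x
        = ∑ ε ∈ ({-1, 0, 1} : Finset ℤ),
            qR.PhiC q (s * t2) c1 c2 c3 (-1) ε (N : ℤ) (n + ε)
              * qR.p q s c1 c2 c3 t2 (N : ℤ) (n + ε) x) := by
  obtain ⟨n, rfl⟩ := Int.eq_ofNat_of_zero_le hn0
  have hw2 : (s * t2) ^ 2 = q * c2 := by rw [mul_pow, hs, ht2]
  have hw : s * t2 ≠ 0 := by
    intro h
    rw [h] at hw2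
    exact mul_ne_zero hq hc2 (by rw [← hw2]; ring)
  have g : qRx.Gen q c1 c2 c3 N :=
    { hq := hq, h1 := hc1, h2 := hc2, h3 := hc3
      g0 := by
        intro m h1 h2 h0
        obtain ⟨m, rfl⟩ := Int.eq_ofNat_of_zero_le (by omega : 0 ≤ m)
        rw [zpow_natCast] at h0
        exact hq1 m (by omega) (by omega) (sub_eq_zero.1 h0).symm
      g1 := fun m a b => qRx.gen_aux q _ hq m (by
        simpa using hgen 1 0 0 (by omega) (by omega) (by omega) (by omega) m a b)
      g2 := fun m a b => qRx.gen_aux q _ hq m (by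
        simpa using hgen 0 1 0 (by omega) (by omega) (by omega) (by omega) m a b)
      g3 := fun m a b => qRx.gen_aux q _ hq m (by
        simpa using hgen 0 0 1 (by omega) (by omega) (by omega) (by omega) m a b)
      gd := fun m a b => qRx.gen_aux q _ hq m (by
        simpa using hgen 0 1 1 (by omega) (by omega) (by omega) (by omega) m a b)
      gC := fun m a b => qRx.gen_aux q _ hq m (by
        simpa using hgen 1 1 1 (by omega) (by omega) (by omega) (by omega) m a b) }
  have hm := qRx.main N q s c1 c2 c3 t2 hw hw2 g hq1 n x (by omega) hx0 hxN
  rw [Finset.sum_insert (by decide), Finset.sum_insert (by decide), Finset.sum_singleton,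
    Finset.sum_insert (by decide), Finset.sum_insert (by decide), Finset.sum_singleton]
  simpa [qR.PhiC, ← sub_eq_add_neg] using hm
end
end
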